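/- arXiv:math/0305349 — 2 statements merged into one kernel-verified Lean document; each statement's English description precedes it below -/
import Mathlib

section
/- Assume p(x,x) ≥ 1/2 for all x ∈ V. Then for every ε > 0 and all x, y ∈ V, if n ≥ 1 + ∫_{4(π(x) ∧ π(y))}^{4/ε} (4/(u Φ(u)²)) du, then |p^n(x,y)/π(y) − 1| ≤ ε. In particular, the ε-uniform mixing time τ(ε) = min{n : |p^n(x,y)/π(y) − 1| ≤ ε for all x, y ∈ V} satisfies τ(ε) ≤ 1 + ∫_{4π_*}^{4/ε} (4/(u Φ(u)²)) du, where π_* = min_{x∈V} π(x). -/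
open MeasureTheory Set
open scoped ENNReal Classical

namespace EvolvingSetsPaper

variable {V : Type*}

/-- `π(S) = ∑_{y ∈ S} π(y)`. -/
noncomputable def piS (pi : V → ℝ) (S : Set V) : ℝ := ∑' y : S, pi y

/-- `Q(S, y) = ∑_{s ∈ S} π(s) p(s, y)`. -/
noncomputable def QS (pi : V → ℝ) (p : V → V → ℝ) (S : Set V) (y : V) : ℝ :=
  ∑' s : S, pi s * p s y

/-- `Q(S, A) = ∑_{s ∈ S, a ∈ A} π(s) p(s, a)`. -/
noncomputable def Qset (pi : V → ℝ) (p : V → V → ℝ) (S A : Set V) : ℝ :=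
  ∑' a : A, QS pi p S a

/-- The conductance `Φ_S = Q(S, Sᶜ)/π(S)`. -/
noncomputable def cond (pi : V → ℝ) (p : V → V → ℝ) (S : Set V) : ℝ :=
  Qset pi p S Sᶜ / piS pi S

/-- The conductance profile `Φ(r)`, constant for `r > 1/2`. -/
noncomputable def profile (pi : V → ℝ) (p : V → V → ℝ) (r : ℝ) : ℝ :=
  if r ≤ 1 / 2 then sInf (cond pi p '' {S : Set V | 0 < piS pi S ∧ piS pi S ≤ r})
  else sInf (cond pi p '' {S : Set V | 0 < piS pi S ∧ piS pi S ≤ 1 / 2})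

/-- `n`-step transition probabilities. -/
noncomputable def pn (p : V → V → ℝ) : ℕ → V → V → ℝ
  | 0 => fun x y => if x = y then 1 else 0
  | n + 1 => fun x y => ∑' z, pn p n x z * p z y

/-- One step of the evolving set process with uniform value `u`:
`S̃ = {y : Q(S,y) ≥ u π(y)}`. -/
def esStep (pi : V → ℝ) (p : V → V → ℝ) (S : Set V) (u : ℝ) : Set V :=
  {y | u * pi y ≤ QS pi p S y}

/-- `esE pi p n F S = E_S[F(S_n)]` for the evolving set process started at `S`,
driven by i.i.d. uniform variables on `[0,1]`. -/
noncomputable def esE (pi : V → ℝ) (p : V → V → ℝ) : ℕ → (Set V → ℝ) → Set V → ℝ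
  | 0 => fun F S => F S
  | n + 1 => fun F S => ∫ u in (0:ℝ)..1, esE pi p n F (esStep pi p S u)

/-- `ψ(S) = 1 - E_S √(π(S̃)/π(S))`. -/
noncomputable def psiSet (pi : V → ℝ) (p : V → V → ℝ) (S : Set V) : ℝ :=
  1 - ∫ u in (0:ℝ)..1, Real.sqrt (piS pi (esStep pi p S u) / piS pi S)

/-- The root profile `ψ(r)`, constant for `r > 1/2`. -/
noncomputable def rootProfile (pi : V → ℝ) (p : V → V → ℝ) (r : ℝ) : ℝ :=
  if r ≤ 1 / 2 then sInf (psiSet pi p '' {S : Set V | 0 < piS pi S ∧ piS pi S ≤ r})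
  else sInf (psiSet pi p '' {S : Set V | 0 < piS pi S ∧ piS pi S ≤ 1 / 2})

/-- `φ_S = (1/(2π(S))) ∑_y min(Q(S,y), Q(Sᶜ,y))`. -/
noncomputable def phiS (pi : V → ℝ) (p : V → V → ℝ) (S : Set V) : ℝ :=
  (1 / (2 * piS pi S)) * ∑' y, min (QS pi p S y) (QS pi p Sᶜ y)

/-- `S^♯ = S` if `π(S) ≤ 1/2`, else `Sᶜ`. -/
noncomputable def sharp (pi : V → ℝ) (S : Set V) : Set V :=
  if piS pi S ≤ 1 / 2 then S else Sᶜ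

/-- `χ²(μ, π) = ∑_y π(y) (μ(y)/π(y) - 1)²`. -/
noncomputable def chiSq (pi : V → ℝ) (mu : V → ℝ) : ℝ :=
  ∑' y, pi y * (mu y / pi y - 1) ^ 2


/-! Helper lemmas -/

noncomputable def ind (S : Set V) (y : V) : ℝ := if y ∈ S then 1 else 0

lemma ind_nonneg (S : Set V) (y : V) : 0 ≤ ind S y := by unfold ind; split_ifs <;> simp
lemma ind_le_one (S : Set V) (y : V) : ind S y ≤ 1 := by unfold ind; split_ifs <;> simp

lemma tsum_ind (c : V → ℝ) (S : Set V) : ∑' y : S, c y = ∑' y, c y * ind S y := by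
  rw [tsum_subtype]
  congr 1; ext y
  by_cases h : y ∈ S <;> simp [ind, h]

lemma summable_ind {c : V → ℝ} (h0 : ∀ y, 0 ≤ c y) (hs : Summable c) (S : Set V) :
    Summable (fun y => c y * ind S y) :=
  Summable.of_nonneg_of_le (fun y => mul_nonneg (h0 y) (ind_nonneg S y))
    (fun y => mul_le_of_le_one_right (h0 y) (ind_le_one S y)) hs

lemma ind_compl (S : Set V) (y : V) : ind Sᶜ y = 1 - ind S y := by
  by_cases h : y ∈ S <;> simp [ind, h]

structure Chain (pi : V → ℝ) (p : V → V → ℝ) : Prop where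
  p0 : ∀ x y, 0 ≤ p x y
  p1 : ∀ x, HasSum (p x) 1
  pos : ∀ x, 0 < pi x
  pi1 : HasSum pi 1
  stat : ∀ y, HasSum (fun x => pi x * p x y) (pi y)
  lazy : ∀ x, (1 : ℝ) / 2 ≤ p x x

lemma measurable_ind (y : V) : Measurable (fun S : Set V => ind S y) := by
  unfold ind
  refine Measurable.ite ?_ measurable_const measurable_const
  exact measurableSet_setOfPred.2 (measurable_set_mem y)

lemma measurable_tsum_ind [Countable V] (c : V → ℝ) :
    Measurable (fun S : Set V => ∑' y, c y * ind S y) :=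
  Measurable.tsum fun y => (measurable_ind y).const_mul _

lemma measurable_piS [Countable V] (pi : V → ℝ) : Measurable (piS pi) := by
  have : piS pi = fun S : Set V => ∑' y, pi y * ind S y := by
    ext S; exact tsum_ind pi S
  rw [this]; exact measurable_tsum_ind pi

lemma QS_eq (pi : V → ℝ) (p : V → V → ℝ) (S : Set V) (y : V) :
    QS pi p S y = ∑' s, (pi s * p s y) * ind S s := tsum_ind (fun s => pi s * p s y) S

lemma measurable_QS [Countable V] (pi : V → ℝ) (p : V → V → ℝ) (y : V) :
    Measurable (fun S => QS pi p S y) := by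
  simp_rw [QS_eq]; exact measurable_tsum_ind _

lemma measurable_esStep [Countable V] (pi : V → ℝ) (p : V → V → ℝ) :
    Measurable (fun q : Set V × ℝ => esStep pi p q.1 q.2) := by
  rw [measurable_set_iff]
  intro a
  refine measurableSet_setOfPred.1 ?_
  exact measurableSet_le (measurable_snd.mul_const _) ((measurable_QS pi p a).comp measurable_fst)

lemma measurable_esStep_right [Countable V] (pi : V → ℝ) (p : V → V → ℝ) (S : Set V) :
    Measurable (fun u : ℝ => esStep pi p S u) :=
  (measurable_esStep pi p).comp (measurable_const.prodMk measurable_id)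

lemma swap_sum {X : Type*} [MeasurableSpace X] (μ : Measure X) [IsFiniteMeasure μ] [Countable V]
    (c : V → ℝ) (hc : ∀ y, 0 ≤ c y) (hs : Summable c) (g : V → X → ℝ)
    (hg : ∀ y, Measurable (g y)) (h0 : ∀ y x, 0 ≤ g y x) (h1 : ∀ y x, g y x ≤ 1) :
    ∫ x, ∑' y, c y * g y x ∂μ = ∑' y, c y * ∫ x, g y x ∂μ := by
  have hint : ∀ y, Integrable (g y) μ := fun y =>
    Integrable.of_mem_Icc 0 1 (hg y).aemeasurable (ae_of_all _ fun x => ⟨h0 y x, h1 y x⟩)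
  rw [← integral_tsum_of_summable_integral_norm]
  · simp_rw [integral_const_mul]
  · intro y; exact (hint y).const_mul _
  · have : ∀ y, ∫ x, ‖c y * g y x‖ ∂μ = c y * ∫ x, g y x ∂μ := by
      intro y
      rw [← integral_const_mul]
      congr 1; ext x
      rw [Real.norm_of_nonneg (mul_nonneg (hc y) (h0 y x))]
    simp_rw [this]
    refine Summable.of_nonneg_of_le (fun y => mul_nonneg (hc y) (integral_nonneg (h0 y)))
      (fun y => mul_le_mul_of_nonneg_left ?_ (hc y)) (hs.mul_right (μ.real univ))
    calc ∫ x, g y x ∂μ ≤ ∫ x, (1:ℝ) ∂μ :=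
          integral_mono (hint y) (integrable_const _) (h1 y)
      _ = μ.real univ := by simp

namespace Chain
variable {pi : V → ℝ} {p : V → V → ℝ}

lemma piS_eq (S : Set V) : piS pi S = ∑' y, pi y * ind S y := tsum_ind pi S

lemma piS_nonneg (h : Chain pi p) (S : Set V) : 0 ≤ piS pi S :=
  tsum_nonneg fun y => (h.pos y).le

lemma piS_mono (h : Chain pi p) {S T : Set V} (hST : S ⊆ T) : piS pi S ≤ piS pi T := by
  rw [piS_eq, piS_eq]
  refine Summable.tsum_le_tsum (fun y => ?_) (summable_ind (fun y => (h.pos y).le) h.pi1.summable S)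
    (summable_ind (fun y => (h.pos y).le) h.pi1.summable T)
  refine mul_le_mul_of_nonneg_left ?_ (h.pos y).le
  by_cases hy : y ∈ S
  · simp [ind, hy, hST hy]
  · simp only [ind, hy, if_false]; split_ifs <;> simp

lemma piS_compl (h : Chain pi p) (S : Set V) : piS pi Sᶜ = 1 - piS pi S := by
  rw [piS_eq, piS_eq, ← h.pi1.tsum_eq,
    ← h.pi1.summable.tsum_sub (summable_ind (fun y => (h.pos y).le) h.pi1.summable S)]
  congr 1; ext y; rw [ind_compl]; ring

lemma piS_le_one (h : Chain pi p) (S : Set V) : piS pi S ≤ 1 := by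
  have := h.piS_compl S; have := h.piS_nonneg Sᶜ; linarith

lemma piS_singleton (x : V) : piS pi {x} = pi x := by
  rw [piS_eq, tsum_eq_single x]
  · simp [ind]
  · intro y hy; simp [ind, hy]

lemma q0 (h : Chain pi p) (x y : V) : 0 ≤ pi x * p x y := mul_nonneg (h.pos x).le (h.p0 x y)

lemma QS_nonneg (h : Chain pi p) (S : Set V) (y : V) : 0 ≤ QS pi p S y :=
  tsum_nonneg fun s => h.q0 s y

lemma QS_add_compl (h : Chain pi p) (S : Set V) (y : V) :
    QS pi p S y + QS pi p Sᶜ y = pi y := by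
  rw [QS_eq, QS_eq, ← (summable_ind (fun s => h.q0 s y) (h.stat y).summable S).tsum_add
    (summable_ind (fun s => h.q0 s y) (h.stat y).summable Sᶜ), ← (h.stat y).tsum_eq]
  congr 1; ext s; rw [ind_compl]; ring

lemma QS_le (h : Chain pi p) (S : Set V) (y : V) : QS pi p S y ≤ pi y := by
  have := h.QS_add_compl S y; have := h.QS_nonneg Sᶜ y; linarith

lemma QS_half (h : Chain pi p) {S : Set V} {y : V} (hy : y ∈ S) : pi y / 2 ≤ QS pi p S y := by
  rw [QS_eq]
  have := (summable_ind (fun s => h.q0 s y) (h.stat y).summable S).le_tsum y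
    (fun s _ => mul_nonneg (h.q0 s y) (ind_nonneg S s))
  refine le_trans ?_ this
  have hi : ind S y = 1 := by simp [ind, hy]
  rw [hi]
  nlinarith [h.lazy y, h.pos y]

lemma summable_prod (h : Chain pi p) : Summable (fun q : V × V => pi q.1 * p q.1 q.2) := by
  have h0 : (0 : V × V → ℝ) ≤ fun q : V × V => pi q.1 * p q.1 q.2 := fun q => h.q0 q.1 q.2
  have h1 : ∀ x, Summable (fun y => pi x * p x y) := fun x => (h.p1 x).summable.mul_left (pi x)
  have h2 : (fun x => ∑' y, pi x * p x y) = pi := by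
    ext x; rw [tsum_mul_left, (h.p1 x).tsum_eq, mul_one]
  have h3 : Summable (fun x => ∑' y, pi x * p x y) := by rw [h2]; exact h.pi1.summable
  exact (summable_prod_of_nonneg h0).2 ⟨h1, h3⟩

lemma summable_QS (h : Chain pi p) (S : Set V) : Summable (QS pi p S) :=
  Summable.of_nonneg_of_le (h.QS_nonneg S) (h.QS_le S) h.pi1.summable

/-- ∑_y Q(S,y) f(y) swapped -/
lemma tsum_QS_mul (h : Chain pi p) (S T : Set V) :
    ∑' y, QS pi p S y * ind T y = ∑' s, ind S s * ∑' y, pi s * p s y * ind T y := by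
  have hs : Summable (Function.uncurry fun (s y : V) => pi s * p s y * ind S s * ind T y) := by
    refine Summable.of_nonneg_of_le (fun q => ?_) (fun q => ?_) h.summable_prod
    · exact mul_nonneg (mul_nonneg (h.q0 _ _) (ind_nonneg _ _)) (ind_nonneg _ _)
    · exact (mul_le_of_le_one_right (mul_nonneg (h.q0 _ _) (ind_nonneg _ _)) (ind_le_one _ _)).trans
        (mul_le_of_le_one_right (h.q0 _ _) (ind_le_one _ _))
  have := hs.tsum_comm
  simp_rw [QS_eq, ← tsum_mul_right, ← tsum_mul_left]
  rw [this]
  congr 1; ext s; congr 1; ext y; ring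

lemma tsum_QS (h : Chain pi p) (S : Set V) : ∑' y, QS pi p S y = piS pi S := by
  have := h.tsum_QS_mul S univ
  simp only [ind, mem_univ, if_true, mul_one] at this
  rw [this, piS_eq]
  congr 1; ext s
  rw [tsum_mul_left, (h.p1 s).tsum_eq, ind]; ring

lemma Qset_eq (S T : Set V) : Qset pi p S T = ∑' y, QS pi p S y * ind T y :=
  tsum_ind (QS pi p S) T

lemma Qset_compl (h : Chain pi p) (S : Set V) :
    Qset pi p S Sᶜ = piS pi S - Qset pi p S S := by
  rw [Qset_eq, Qset_eq, ← h.tsum_QS, ← (h.summable_QS S).tsum_sub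
    (summable_ind (h.QS_nonneg S) (h.summable_QS S) S)]
  congr 1; ext y; rw [ind_compl]; ring

/-- time reversal -/
noncomputable def rev (pi : V → ℝ) (p : V → V → ℝ) : V → V → ℝ := fun x y => pi y * p y x / pi x

lemma pi_rev (h : Chain pi p) (x y : V) : pi x * rev pi p x y = pi y * p y x := by
  unfold rev; field_simp [(h.pos x).ne']

lemma isRev (h : Chain pi p) : Chain pi (rev pi p) where
  p0 x y := div_nonneg (h.q0 y x) (h.pos x).le
  p1 x := by
    have := (h.stat x).div_const (pi x)
    rwa [div_self (h.pos x).ne'] at this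
  pos := h.pos
  pi1 := h.pi1
  stat y := by
    simp_rw [h.pi_rev]
    simpa using (h.p1 y).mul_left (pi y)
  lazy x := by
    have := h.lazy x
    have hx := (h.pos x).ne'
    unfold rev
    rwa [mul_div_cancel_left₀ _ hx]

lemma Qset_rev (h : Chain pi p) (S : Set V) : Qset pi (rev pi p) S S = Qset pi p S S := by
  rw [Qset_eq, Qset_eq, h.tsum_QS_mul]
  congr 1; ext s
  rw [QS_eq]
  simp_rw [h.pi_rev]
  ring

lemma cond_rev (h : Chain pi p) : cond pi (rev pi p) = cond pi p := by
  ext S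
  rw [cond, cond, h.isRev.Qset_compl, h.Qset_compl, h.Qset_rev]

lemma profile_rev (h : Chain pi p) : profile pi (rev pi p) = profile pi p := by
  ext r
  rw [profile, profile, h.cond_rev]

end Chain
namespace Chain
variable {pi : V → ℝ} {p : V → V → ℝ}

lemma integral_step_mem (h : Chain pi p) (S : Set V) (y : V) {c : ℝ} (hc : 0 ≤ c) :
    ∫ u in Ioc 0 c, ind (esStep pi p S u) y = min c (QS pi p S y / pi y) := by
  have hq : 0 ≤ QS pi p S y / pi y := div_nonneg (h.QS_nonneg S y) (h.pos y).le
  have : (fun u => ind (esStep pi p S u) y) =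
      (Iic (QS pi p S y / pi y)).indicator (fun _ => (1:ℝ)) := by
    ext u
    simp only [ind, esStep, mem_ofPred_eq, Set.indicator, mem_Iic, le_div_iff₀ (h.pos y)]
    split_ifs with h1 <;> first | rfl | exact if_pos h1 | exact if_neg h1
  rw [this, setIntegral_indicator measurableSet_Iic]
  have h2 : Ioc 0 c ∩ Iic (QS pi p S y / pi y) = Ioc 0 (min c (QS pi p S y / pi y)) := by
    ext u; simp
  rw [h2]
  simp [hc, hq]

lemma measurable_g [Countable V] (S : Set V) :
    Measurable (fun u : ℝ => piS pi (esStep pi p S u)) :=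
  (measurable_piS pi).comp (measurable_esStep_right pi p S)

lemma integral_step [Countable V] (h : Chain pi p) (S : Set V) {c : ℝ} (hc : 0 ≤ c) :
    ∫ u in Ioc 0 c, piS pi (esStep pi p S u) = ∑' y, pi y * min c (QS pi p S y / pi y) := by
  simp_rw [piS_eq]
  rw [swap_sum _ pi (fun y => (h.pos y).le) h.pi1.summable
    (fun y u => ind (esStep pi p S u) y)
    (fun y => (measurable_ind y).comp (measurable_esStep_right pi p S))
    (fun y u => ind_nonneg _ _) (fun y u => ind_le_one _ _)]
  simp_rw [h.integral_step_mem S _ hc]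

lemma integral_step_one [Countable V] (h : Chain pi p) (S : Set V) :
    ∫ u in Ioc (0:ℝ) 1, piS pi (esStep pi p S u) = piS pi S := by
  rw [h.integral_step S zero_le_one, ← h.tsum_QS]
  congr 1; ext y
  have hy := h.pos y
  rw [min_eq_right ((div_le_one hy).2 (h.QS_le S y)), mul_div_cancel₀ _ hy.ne']

lemma integral_step_half [Countable V] (h : Chain pi p) (S : Set V) :
    ∫ u in Ioc (0:ℝ) (1/2), piS pi (esStep pi p S u) = piS pi S / 2 + Qset pi p S Sᶜ := by
  rw [h.integral_step S (by norm_num), piS_eq, Qset_eq, ← tsum_div_const,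
    ← ((summable_ind (fun y => (h.pos y).le) h.pi1.summable S).div_const 2).tsum_add
      (summable_ind (h.QS_nonneg S) (h.summable_QS S) Sᶜ)]
  congr 1; ext y
  have hy := h.pos y
  by_cases hyS : y ∈ S
  · rw [min_eq_left]
    · simp [ind, hyS]; ring
    · rw [le_div_iff₀ hy]; linarith [h.QS_half hyS]
  · rw [min_eq_right, mul_div_cancel₀ _ hy.ne']
    · simp [ind, hyS]
    · rw [div_le_iff₀ hy]
      have := h.QS_half (S := Sᶜ) (y := y) hyS
      have := h.QS_add_compl S y
      linarith

lemma integrable_g [Countable V] (h : Chain pi p) (S : Set V) (a b : ℝ) :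
    IntegrableOn (fun u : ℝ => piS pi (esStep pi p S u)) (Ioc a b) :=
  Integrable.of_mem_Icc 0 1 (measurable_g S).aemeasurable
    (ae_of_all _ fun _ => ⟨h.piS_nonneg _, h.piS_le_one _⟩)

lemma sqrt_le_one' (h : Chain pi p) (S : Set V) : √(piS pi S) ≤ 1 :=
  Real.sqrt_le_one.2 (h.piS_le_one S)

lemma integrable_sqrt [Countable V] (h : Chain pi p) (S : Set V) (a b : ℝ) :
    IntegrableOn (fun u : ℝ => √(piS pi (esStep pi p S u))) (Ioc a b) :=
  Integrable.of_mem_Icc 0 1 (measurable_g S).sqrt.aemeasurable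
    (ae_of_all _ fun _ => ⟨Real.sqrt_nonneg _, h.sqrt_le_one' _⟩)

lemma integral_split {f : ℝ → ℝ} (hf : ∀ a b : ℝ, IntegrableOn f (Ioc a b)) :
    ∫ u in Ioc (0:ℝ) 1, f u = (∫ u in Ioc (0:ℝ) (1/2), f u) + ∫ u in Ioc (1/2:ℝ) 1, f u := by
  rw [← setIntegral_union _ measurableSet_Ioc (hf _ _) (hf _ _),
    Ioc_union_Ioc_eq_Ioc (by norm_num) (by norm_num)]
  exact Set.Ioc_disjoint_Ioc_of_le le_rfl

lemma sqrt_bound [Countable V] (h : Chain pi p) (S : Set V) (hP : 0 < piS pi S)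
    {s a b : ℝ} (hs : 0 < s) (hab : b - a = 1/2) :
    ∫ u in Ioc a b, √(piS pi (esStep pi p S u)) ≤
      ((∫ u in Ioc a b, piS pi (esStep pi p S u)) + s ^ 2 * piS pi S / 2) /
        (2 * s * √(piS pi S)) := by
  have hsq := Real.sqrt_pos.2 hP
  have h1 : ∀ u, √(piS pi (esStep pi p S u)) ≤
      (piS pi (esStep pi p S u) + s ^ 2 * piS pi S) / (2 * s * √(piS pi S)) := by
    intro u
    rw [le_div_iff₀ (by positivity)]
    nlinarith [sq_nonneg (√(piS pi (esStep pi p S u)) - s * √(piS pi S)),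
      Real.sq_sqrt (h.piS_nonneg (esStep pi p S u)), Real.sq_sqrt hP.le]
  have hc : IntegrableOn (fun _ : ℝ => s ^ 2 * piS pi S) (Ioc a b) :=
    integrable_const _
  calc _ ≤ ∫ u in Ioc a b, (piS pi (esStep pi p S u) + s ^ 2 * piS pi S) / (2 * s * √(piS pi S)) :=
        integral_mono (h.integrable_sqrt S a b) (((h.integrable_g S a b).add hc).div_const _) h1
    _ = _ := by
        rw [integral_div, integral_add (h.integrable_g S a b) hc]
        congr 2
        simp [hab, Real.volume_real_Ioc]
        ring

lemma cond_nonneg (h : Chain pi p) (S : Set V) : 0 ≤ cond pi p S :=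
  div_nonneg (tsum_nonneg fun y => h.QS_nonneg S y) (h.piS_nonneg S)

lemma key [Countable V] (h : Chain pi p) (S : Set V) :
    ∫ u in Ioc (0:ℝ) 1, √(piS pi (esStep pi p S u)) ≤
      √(piS pi S) * (1 - cond pi p S ^ 2 / 2) := by
  rcases (h.piS_nonneg S).eq_or_lt with hP | hP
  · have hQ : ∀ y, QS pi p S y = 0 := by
      intro y
      have h1 := h.tsum_QS S
      rw [← hP] at h1
      have h2 := (h.summable_QS S).le_tsum y (fun z _ => h.QS_nonneg S z)
      linarith [h.QS_nonneg S y]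
    have : ∫ u in Ioc (0:ℝ) 1, √(piS pi (esStep pi p S u)) = ∫ u in Ioc (0:ℝ) 1, (0:ℝ) := by
      refine setIntegral_congr_fun measurableSet_Ioc fun u hu => ?_
      have : esStep pi p S u = ∅ := by
        ext y
        simp only [esStep, mem_ofPred_eq, hQ, mem_empty_iff_false, iff_false, not_le]
        exact mul_pos hu.1 (h.pos y)
      simp [this, piS]
    rw [this, ← hP]; simp
  · have hQ : Qset pi p S Sᶜ = cond pi p S * piS pi S := by
      rw [cond, div_mul_cancel₀ _ hP.ne']
    set F := cond pi p S with hF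
    set P := piS pi S with hPd
    have hF0 : 0 ≤ F := h.cond_nonneg S
    have e1 := h.integral_step_one S
    have e2 := h.integral_step_half S
    have e3 := integral_split (h.integrable_g S)
    rw [e1, e2, hQ] at e3
    have e4 : 0 ≤ ∫ u in Ioc (1/2:ℝ) 1, piS pi (esStep pi p S u) :=
      integral_nonneg fun u => h.piS_nonneg _
    have hF1 : F ≤ 1 / 2 := by
      by_contra hcon
      push Not at hcon
      nlinarith
    rw [integral_split (h.integrable_sqrt S)]
    have b1 := h.sqrt_bound S hP (s := 1 + F) (a := 0) (b := 1/2) (by linarith) (by norm_num)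
    have b2 := h.sqrt_bound S hP (s := 1 - F) (a := 1/2) (b := 1) (by linarith) (by norm_num)
    rw [e2, hQ] at b1
    have e5 : ∫ u in Ioc (1/2:ℝ) 1, piS pi (esStep pi p S u) = P * (1/2 - F) := by
      change P = P / 2 + F * P + _ at e3
      linarith
    rw [e5] at b2
    refine (add_le_add b1 b2).trans ?_
    have hsq := Real.sqrt_pos.2 hP
    have hPs : P = √P * √P := (Real.mul_self_sqrt hP.le).symm
    have c1 : (P / 2 + F * P + (1 + F) ^ 2 * P / 2) / (2 * (1 + F) * √P) =
        √P * ((1 + 2 * F + F ^ 2 / 2) / (2 * (1 + F))) := by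
      have : 1 + F ≠ 0 := by linarith
      rw [← sub_eq_zero]
      field_simp
      rw [Real.sq_sqrt hP.le]; ring
    have c2 : (P * (1 / 2 - F) + (1 - F) ^ 2 * P / 2) / (2 * (1 - F) * √P) =
        √P * ((1 - 2 * F + F ^ 2 / 2) / (2 * (1 - F))) := by
      have : 1 - F ≠ 0 := by linarith
      rw [← sub_eq_zero]
      field_simp
      rw [Real.sq_sqrt hP.le]; ring
    change (P / 2 + F * P + (1 + F) ^ 2 * P / 2) / (2 * (1 + F) * √P) +
      (P * (1 / 2 - F) + (1 - F) ^ 2 * P / 2) / (2 * (1 - F) * √P) ≤ _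
    rw [c1, c2, ← mul_add]
    refine mul_le_mul_of_nonneg_left ?_ hsq.le
    have h1 : 0 < 1 + F := by linarith
    have h2 : 0 < 1 - F := by linarith
    rw [div_add_div _ _ (by positivity) (by positivity), div_le_iff₀ (by positivity)]
    nlinarith [pow_nonneg hF0 4, pow_nonneg hF0 3, pow_nonneg hF0 2]

noncomputable def sh (pi : V → ℝ) (S : Set V) : ℝ := √(piS pi (sharp pi S))

lemma sharp_le_half (h : Chain pi p) (S : Set V) : piS pi (sharp pi S) ≤ 1 / 2 := by
  unfold sharp; split_ifs with hS
  · exact hS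
  · rw [h.piS_compl]; linarith

lemma piS_sharp (h : Chain pi p) (S : Set V) :
    piS pi (sharp pi S) = min (piS pi S) (1 - piS pi S) := by
  unfold sharp; split_ifs with hS
  · rw [min_eq_left]; linarith
  · rw [h.piS_compl, min_eq_right]; linarith

lemma measurable_sh [Countable V] (h : Chain pi p) : Measurable (sh pi) := by
  unfold sh
  simp_rw [h.piS_sharp]
  exact ((measurable_piS pi).min ((measurable_piS pi).const_sub 1)).sqrt

lemma sh_nonneg (S : Set V) : 0 ≤ sh pi S := Real.sqrt_nonneg _
lemma sh_le_one (h : Chain pi p) (S : Set V) : sh pi S ≤ 1 := h.sqrt_le_one' _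

lemma integrable_sh_step [Countable V] (h : Chain pi p) (S : Set V) :
    IntegrableOn (fun u : ℝ => sh pi (esStep pi p S u)) (Ioc 0 1) :=
  Integrable.of_mem_Icc 0 1 (h.measurable_sh.comp (measurable_esStep_right pi p S)).aemeasurable
    (ae_of_all _ fun _ => ⟨sh_nonneg _, h.sh_le_one _⟩)

lemma key_sharp [Countable V] (h : Chain pi p) (S : Set V) :
    ∫ u in Ioc (0:ℝ) 1, sh pi (esStep pi p S u) ≤
      sh pi S * (1 - cond pi p (sharp pi S) ^ 2 / 2) := by
  by_cases hS : piS pi S ≤ 1 / 2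
  · have e : sharp pi S = S := by simp only [sharp, hS, if_true]
    rw [sh, e]
    refine le_trans (integral_mono (h.integrable_sh_step S) (h.integrable_sqrt S 0 1) ?_) (h.key S)
    intro u
    exact Real.sqrt_le_sqrt (by rw [h.piS_sharp]; exact min_le_left _ _)
  · have e : sharp pi S = Sᶜ := by simp only [sharp, hS, if_false]
    rw [sh, e]
    refine le_trans ?_ (h.key Sᶜ)
    have e2 : ∫ u in Ioc (0:ℝ) 1, √(piS pi (esStep pi p Sᶜ u)) =
        ∫ u in Ioc (0:ℝ) 1, √(piS pi (esStep pi p Sᶜ (1 - u))) := by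
      rw [← intervalIntegral.integral_of_le zero_le_one,
        ← intervalIntegral.integral_of_le zero_le_one,
        intervalIntegral.integral_comp_sub_left (fun u => √(piS pi (esStep pi p Sᶜ u))) 1]
      simp
    rw [e2]
    refine integral_mono (h.integrable_sh_step S) ?_ ?_
    · exact Integrable.of_mem_Icc 0 1
        (((measurable_g (pi := pi) (p := p) Sᶜ).comp (measurable_const.sub measurable_id)).sqrt).aemeasurable
        (ae_of_all _ fun _ => ⟨Real.sqrt_nonneg _, h.sqrt_le_one' _⟩)
    · intro u
      refine Real.sqrt_le_sqrt ?_
      rw [h.piS_sharp]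
      refine (min_le_right _ _).trans ?_
      rw [← h.piS_compl]
      refine h.piS_mono ?_
      intro y hy
      simp only [esStep, mem_compl_iff, mem_ofPred_eq, not_le] at hy ⊢
      have := h.QS_add_compl S y
      linarith

end Chain
lemma ode (Φ : ℝ → ℝ) (hΦ0 : ∀ r, 0 ≤ Φ r) {v0 : ℝ} (hv0 : 0 < v0)
    (hΦ : ∀ r s, v0 ≤ r → r ≤ s → Φ s ≤ Φ r) (c : ℕ → ℝ)
    (hc0 : c 0 ≤ 4 / v0)
    (hc : ∀ k, 0 < c k → 4 / c k ≥ v0 → c (k+1) ≤ c k * Real.exp (-(Φ (4 / c k) ^ 2 / 4)))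
    (hcm : ∀ k, c (k+1) ≤ c k)
    {ε : ℝ} (hε : 0 < ε) (n : ℕ)
    (hn : (∫⁻ u in Ioc v0 (4 / ε), 4 / ENNReal.ofReal (u * Φ u ^ 2)) ≤ (n : ℝ≥0∞)) :
    c n ≤ ε := by
  by_contra hcon
  push Not at hcon
  have hanti : Antitone c := antitone_nat_of_succ_le hcm
  have hpos : ∀ k ≤ n, 0 < c k := fun k hk => (hε.trans hcon).trans_le (hanti hk)
  have hv : ∀ k ≤ n, v0 ≤ 4 / c k := by
    intro k hk
    rw [le_div_iff₀ (hpos k hk)]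
    have := (hanti (Nat.zero_le k)).trans hc0
    rw [le_div_iff₀ hv0] at this
    linarith
  have hlt : 4 / c n < 4 / ε := div_lt_div_of_pos_left (by norm_num) hε hcon
  have hvn := hv n le_rfl
  set f : ℝ → ℝ≥0∞ := fun u => 4 / ENNReal.ofReal (u * Φ u ^ 2) with hf
  have hlow : 4 / ENNReal.ofReal (4 / ε * Φ (4 / c n) ^ 2) * ENNReal.ofReal (4 / ε - 4 / c n)
      ≤ ∫⁻ u in Ioc (4 / c n) (4 / ε), f u := by
    rw [← Real.volume_Ioc, ← setLIntegral_const]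
    refine setLIntegral_mono' measurableSet_Ioc fun u hu => ?_
    refine ENNReal.div_le_div_left (ENNReal.ofReal_le_ofReal ?_) _
    have h1 := hΦ _ _ hvn hu.1.le
    have h2 : 0 < u := hv0.trans_le (hvn.trans hu.1.le)
    exact mul_le_mul hu.2 (pow_le_pow_left₀ (hΦ0 _) h1 2) (by positivity) (h2.le.trans hu.2)
  have hL : 0 < ENNReal.ofReal (4 / ε - 4 / c n) := by
    rw [ENNReal.ofReal_pos]; linarith
  have hsplit : ∀ a b d : ℝ, a ≤ b → b ≤ d →
      ∫⁻ u in Ioc a d, f u = (∫⁻ u in Ioc a b, f u) + ∫⁻ u in Ioc b d, f u := by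
    intro a b d hab hbd
    rw [← lintegral_union measurableSet_Ioc (Set.Ioc_disjoint_Ioc_of_le le_rfl),
      Ioc_union_Ioc_eq_Ioc hab hbd]
  rw [hsplit _ _ _ hvn hlt.le] at hn
  have hΦn : 0 < Φ (4 / c n) := by
    refine lt_of_le_of_ne (hΦ0 _) fun h0 => ?_
    rw [← h0] at hlow
    have : (4 : ℝ≥0∞) / ENNReal.ofReal (4 / ε * 0 ^ 2) * ENNReal.ofReal (4 / ε - 4 / c n) = ⊤ := by
      simp only [ne_eq, OfNat.ofNat_ne_zero, not_false_eq_true, zero_pow, mul_zero,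
        ENNReal.ofReal_zero]
      rw [ENNReal.div_zero (by norm_num), ENNReal.top_mul hL.ne']
    rw [this, top_le_iff] at hlow
    rw [hlow] at hn
    simp at hn
  have hstep : ∀ k, k ≤ n → (k : ℝ≥0∞) ≤ ∫⁻ u in Ioc v0 (4 / c k), f u := by
    intro k
    induction k with
    | zero => intro _; simp
    | succ k ih =>
      intro hk
      have hk' : k ≤ n := by omega
      have p1 := hpos k hk'
      have p2 := hpos (k+1) hk
      have hle : 4 / c k ≤ 4 / c (k+1) := div_le_div_of_nonneg_left (by norm_num) p2 (hcm k)
      rw [hsplit v0 (4 / c k) _ (hv k hk') hle]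
      push_cast
      refine add_le_add (ih hk') ?_
      have hvk := hv k hk'
      have hle' : 4 / c k ≤ 4 / c n := div_le_div_of_nonneg_left (by norm_num) (hpos n le_rfl) (hanti hk')
      have hP : 0 < Φ (4 / c k) := hΦn.trans_le (hΦ _ _ hvk hle')
      set A := Φ (4 / c k) with hA
      set a := 4 / c k with ha
      set b := 4 / c (k+1) with hb
      have ha0 : 0 < a := by positivity
      have hb0 : 0 < b := by positivity
      have hlog : A ^ 2 / 4 ≤ Real.log (b / a) := by
        rw [Real.le_log_iff_exp_le (by positivity)]
        have := hc k p1 hvk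
        rw [Real.exp_neg, ← div_eq_mul_inv, le_div_iff₀ (Real.exp_pos _)] at this
        have e : b / a = c k / c (k+1) := by rw [ha, hb]; field_simp
        rw [e, le_div_iff₀ p2]
        linarith
      have hint : IntervalIntegrable (fun u : ℝ => 4 / A ^ 2 * (1 / u)) volume a b := by
        refine ContinuousOn.intervalIntegrable ?_
        rw [uIcc_of_le hle]
        refine ContinuousOn.mul continuousOn_const (ContinuousOn.div continuousOn_const continuousOn_id ?_)
        intro u hu
        exact (ha0.trans_le hu.1).ne'
      have e1 : ENNReal.ofReal (∫ u in Ioc a b, 4 / A ^ 2 * (1 / u)) =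
          ∫⁻ u in Ioc a b, ENNReal.ofReal (4 / A ^ 2 * (1 / u)) := by
        refine ofReal_integral_eq_lintegral_ofReal ?_ ?_
        · exact (intervalIntegrable_iff_integrableOn_Ioc_of_le hle).1 hint
        · refine (ae_restrict_iff' measurableSet_Ioc).2 (ae_of_all _ fun u hu => ?_)
          have : 0 < u := ha0.trans hu.1
          simp only [Pi.zero_apply]; positivity
      calc (1 : ℝ≥0∞) = ENNReal.ofReal 1 := by simp
        _ ≤ ENNReal.ofReal (∫ u in Ioc a b, 4 / A ^ 2 * (1 / u)) := by
            refine ENNReal.ofReal_le_ofReal ?_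
            rw [← intervalIntegral.integral_of_le hle, intervalIntegral.integral_const_mul,
              integral_one_div_of_pos ha0 hb0]
            calc (1:ℝ) = 4 / A ^ 2 * (A ^ 2 / 4) := by field_simp
              _ ≤ _ := by gcongr
        _ = _ := e1
        _ ≤ _ := by
            refine setLIntegral_mono' measurableSet_Ioc fun u hu => ?_
            have hu0 : 0 < u := ha0.trans hu.1
            have h1 : Φ u ≤ A := hΦ _ _ hvk hu.1.le
            calc ENNReal.ofReal (4 / A ^ 2 * (1 / u)) = ENNReal.ofReal (4 / (u * A ^ 2)) := by
                  congr 1; field_simp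
              _ = 4 / ENNReal.ofReal (u * A ^ 2) := by
                  rw [ENNReal.ofReal_div_of_pos (by positivity)]; simp
              _ ≤ f u := by
                  refine ENNReal.div_le_div_left (ENNReal.ofReal_le_ofReal ?_) _
                  have := hΦ0 u
                  gcongr
  have hfin := (add_le_add (hstep n le_rfl) hlow).trans hn
  have hz : 4 / ENNReal.ofReal (4 / ε * Φ (4 / c n) ^ 2) * ENNReal.ofReal (4 / ε - 4 / c n) ≠ 0 := by
    refine mul_ne_zero ?_ hL.ne'
    exact (ENNReal.div_pos (by norm_num) ENNReal.ofReal_ne_top).ne'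
  have := ENNReal.lt_add_right (ENNReal.natCast_ne_top n) hz
  exact absurd hfin (not_le.2 this)

namespace Chain
variable {pi : V → ℝ} {p : V → V → ℝ}

lemma bddBelow_cond (h : Chain pi p) (A : Set (Set V)) : BddBelow (cond pi p '' A) := by
  refine ⟨0, ?_⟩
  rintro _ ⟨S, _, rfl⟩
  exact h.cond_nonneg S

lemma profile_nonneg (h : Chain pi p) (r : ℝ) : 0 ≤ profile pi p r := by
  unfold profile
  split_ifs <;>
  · refine Real.sInf_nonneg ?_
    rintro _ ⟨S, _, rfl⟩
    exact h.cond_nonneg S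

lemma profile_le (h : Chain pi p) {r : ℝ} {S : Set V} (h0 : 0 < piS pi S) (hr : piS pi S ≤ r)
    (h2 : piS pi S ≤ 1 / 2) : profile pi p r ≤ cond pi p S := by
  unfold profile
  split_ifs
  · exact csInf_le (h.bddBelow_cond _) ⟨S, ⟨h0, hr⟩, rfl⟩
  · exact csInf_le (h.bddBelow_cond _) ⟨S, ⟨h0, h2⟩, rfl⟩

lemma profile_anti (h : Chain pi p) (x : V) {r s : ℝ} (hr : pi x ≤ r) (hrs : r ≤ s) :
    profile pi p s ≤ profile pi p r := by
  by_cases h1 : r ≤ 1 / 2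
  · have e : profile pi p r = sInf (cond pi p '' {S : Set V | 0 < piS pi S ∧ piS pi S ≤ r}) := by
      simp only [profile, h1, if_true]
    rw [e]
    refine le_csInf ⟨_, {x}, ⟨?_, ?_⟩, rfl⟩ ?_
    · rw [piS_singleton]; exact h.pos x
    · rw [piS_singleton]; exact hr
    · rintro _ ⟨S, ⟨h0, hS⟩, rfl⟩
      exact h.profile_le h0 (hS.trans hrs) (hS.trans h1)
  · have h2 : ¬ s ≤ 1 / 2 := fun h' => h1 (hrs.trans h')
    simp only [profile, h1, h2, if_false]; exact le_rfl

instance : IsProbabilityMeasure (volume.restrict (Ioc (0:ℝ) 1)) := ⟨by simp⟩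

noncomputable def esM (pi : V → ℝ) (p : V → V → ℝ) (x : V) : ℕ → Measure (Set V)
  | 0 => Measure.dirac {x}
  | n + 1 => ((esM pi p x n).prod (volume.restrict (Ioc (0:ℝ) 1))).map
      (fun q => esStep pi p q.1 q.2)

instance esM_prob [Countable V] (x : V) (n : ℕ) : IsProbabilityMeasure (esM pi p x n) := by
  induction n with
  | zero => unfold esM; infer_instance
  | succ n ih =>
    unfold esM
    exact Measure.isProbabilityMeasure_map (measurable_esStep pi p).aemeasurable

lemma esM_succ [Countable V] (x : V) (n : ℕ) {F : Set V → ℝ} (hF : Measurable F)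
    (h0 : ∀ S, 0 ≤ F S) (h1 : ∀ S, F S ≤ 1) :
    Integrable (fun S => ∫ u in Ioc (0:ℝ) 1, F (esStep pi p S u)) (esM pi p x n) ∧
    ∫ S, F S ∂(esM pi p x (n+1)) =
      ∫ S, (∫ u in Ioc (0:ℝ) 1, F (esStep pi p S u)) ∂(esM pi p x n) := by
  have hi : Integrable (fun q : Set V × ℝ => F (esStep pi p q.1 q.2))
      ((esM pi p x n).prod (volume.restrict (Ioc (0:ℝ) 1))) :=
    Integrable.of_mem_Icc 0 1 (hF.comp (measurable_esStep pi p)).aemeasurable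
      (ae_of_all _ fun _ => ⟨h0 _, h1 _⟩)
  refine ⟨hi.integral_prod_left, ?_⟩
  rw [esM, integral_map (measurable_esStep pi p).aemeasurable hF.aestronglyMeasurable,
    integral_prod _ hi]

lemma integrable_esM [Countable V] (x : V) (n : ℕ) {F : Set V → ℝ} (hF : Measurable F)
    (h0 : ∀ S, 0 ≤ F S) (h1 : ∀ S, F S ≤ 1) : Integrable F (esM pi p x n) :=
  Integrable.of_mem_Icc 0 1 hF.aemeasurable (ae_of_all _ fun _ => ⟨h0 _, h1 _⟩)

noncomputable def hit (pi : V → ℝ) (p : V → V → ℝ) (x : V) (n : ℕ) (y : V) : ℝ :=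
  ∫ S, ind S y ∂(esM pi p x n)

lemma hit_nonneg (x : V) (n : ℕ) (y : V) : 0 ≤ hit pi p x n y :=
  integral_nonneg fun S => ind_nonneg S y

lemma hit_le_one [Countable V] (x : V) (n : ℕ) (y : V) : hit pi p x n y ≤ 1 := by
  have := integral_mono (integrable_esM (pi := pi) (p := p) x n (measurable_ind y)
    (fun S => ind_nonneg S y) (fun S => ind_le_one S y)) (integrable_const (1:ℝ))
    (fun S => ind_le_one S y)
  simpa [hit] using this

lemma hit_zero (x y : V) : hit pi p x 0 y = if x = y then 1 else 0 := by
  rw [hit, esM, integral_dirac' _ _ (measurable_ind y).stronglyMeasurable]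
  simp only [ind, mem_singleton_iff, eq_comm]

lemma hit_succ [Countable V] (h : Chain pi p) (x : V) (n : ℕ) (y : V) :
    pi y * hit pi p x (n+1) y = ∑' s, pi s * p s y * hit pi p x n s := by
  rw [hit, (esM_succ x n (measurable_ind y) (fun S => ind_nonneg S y)
    (fun S => ind_le_one S y)).2]
  have e : ∀ S, ∫ u in Ioc (0:ℝ) 1, ind (esStep pi p S u) y = QS pi p S y / pi y := by
    intro S
    rw [h.integral_step_mem S y zero_le_one, min_eq_right ((div_le_one (h.pos y)).2 (h.QS_le S y))]
  simp_rw [e]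
  rw [integral_div, mul_div_cancel₀ _ (h.pos y).ne']
  simp_rw [QS_eq]
  rw [swap_sum (esM pi p x n) (fun s => pi s * p s y) (fun s => h.q0 s y) (h.stat y).summable
    (fun s S => ind S s) (fun s => measurable_ind s) (fun s S => ind_nonneg _ _)
    (fun s S => ind_le_one _ _)]
  rfl

lemma pn_hit [Countable V] (h : Chain pi p) (x : V) (n : ℕ) (y : V) :
    pi x * pn p n x y = pi y * hit pi p x n y := by
  induction n generalizing y with
  | zero =>
    rw [hit_zero]
    by_cases hxy : x = y
    · simp [pn, hxy]
    · simp [pn, hxy]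
  | succ n ih =>
    rw [h.hit_succ, pn, ← tsum_mul_left]
    congr 1; ext z
    rw [← mul_assoc, ih]; ring

lemma mass [Countable V] (h : Chain pi p) (x : V) (n : ℕ) :
    ∫ S, piS pi S ∂(esM pi p x n) = pi x := by
  induction n with
  | zero =>
    rw [esM, integral_dirac' _ _ (measurable_piS pi).stronglyMeasurable, piS_singleton]
  | succ n ih =>
    rw [(esM_succ x n (measurable_piS pi) h.piS_nonneg h.piS_le_one).2]
    simp_rw [h.integral_step_one]
    exact ih

lemma conv [Countable V] (h : Chain pi p) (x z : V) (m n : ℕ) :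
    ∑' y, pi y * (hit pi p x n y * hit pi (rev pi p) z m y) = pi x * pn p (n + m) x z := by
  induction m generalizing n with
  | zero =>
    rw [tsum_eq_single z]
    · rw [hit_zero, if_pos rfl, mul_one, add_zero, h.pn_hit]
    · intro y hy
      rw [hit_zero, if_neg (Ne.symm hy)]; simp
  | succ m ih =>
    have e : n + (m + 1) = (n + 1) + m := by ring
    rw [e, ← ih (n+1)]
    have e1 : ∀ y, pi y * (hit pi p x n y * hit pi (rev pi p) z (m+1) y) =
        ∑' s, pi y * p y s * (hit pi p x n y * hit pi (rev pi p) z m s) := by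
      intro y
      have := h.isRev.hit_succ z m y
      rw [mul_left_comm, this, ← tsum_mul_left]
      simp_rw [h.pi_rev]
      congr 1; ext s; ring
    have e2 : ∀ s, pi s * (hit pi p x (n+1) s * hit pi (rev pi p) z m s) =
        ∑' y, pi y * p y s * (hit pi p x n y * hit pi (rev pi p) z m s) := by
      intro s
      rw [← mul_assoc, h.hit_succ x n s, ← tsum_mul_right]
      congr 1; ext y; ring
    simp_rw [e1, e2]
    have hs : Summable (Function.uncurry fun (y s : V) =>
        pi y * p y s * (hit pi p x n y * hit pi (rev pi p) z m s)) := by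
      refine Summable.of_nonneg_of_le (fun q => ?_) (fun q => ?_) h.summable_prod
      · exact mul_nonneg (h.q0 _ _) (mul_nonneg (hit_nonneg _ _ _) (hit_nonneg _ _ _))
      · exact mul_le_of_le_one_right (h.q0 _ _)
          (mul_le_one₀ (hit_le_one _ _ _) (hit_nonneg _ _ _) (hit_le_one _ _ _))
    exact hs.tsum_comm.symm

lemma ind_inter (S T : Set V) (y : V) : ind (S ∩ T) y = ind S y * ind T y := by
  by_cases h1 : y ∈ S <;> by_cases h2 : y ∈ T <;> simp [ind, h1, h2]

lemma inter_add (h : Chain pi p) (S T : Set V) :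
    piS pi (S ∩ T) + piS pi (S ∩ Tᶜ) = piS pi S := by
  have hs := fun S : Set V => summable_ind (fun y => (h.pos y).le) h.pi1.summable S
  rw [piS_eq, piS_eq, piS_eq, ← (hs _).tsum_add (hs _)]
  congr 1; ext y; rw [ind_inter, ind_inter, ind_compl]; ring

lemma cov (h : Chain pi p) (S T : Set V) :
    |piS pi (S ∩ T) - piS pi S * piS pi T| ≤ sh pi S * sh pi T := by
  have a0 := h.piS_nonneg S
  have a1 := h.piS_le_one S
  have b0 := h.piS_nonneg T
  have b1 := h.piS_le_one T
  have t0 := h.piS_nonneg (S ∩ T)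
  have t1 := h.piS_mono (inter_subset_left : S ∩ T ⊆ S)
  have t2 := h.piS_mono (inter_subset_right : S ∩ T ⊆ T)
  have t3 : piS pi S + piS pi T - 1 ≤ piS pi (S ∩ T) := by
    have := h.inter_add S T
    have h2 := h.piS_mono (inter_subset_right : S ∩ Tᶜ ⊆ Tᶜ)
    rw [h.piS_compl] at h2
    linarith
  rw [sh, sh, h.piS_sharp, h.piS_sharp]
  generalize piS pi (S ∩ T) = t at *
  generalize piS pi S = a at *
  generalize piS pi T = b at *
  have hA : |t - a * b| ≤ min a (1 - a) := by
    rw [le_min_iff, abs_le, abs_le]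
    refine ⟨⟨?_, ?_⟩, ?_, ?_⟩ <;> nlinarith [mul_nonneg a0 b0, mul_nonneg a0 (sub_nonneg.2 b1),
      mul_nonneg b0 (sub_nonneg.2 a1), mul_nonneg (sub_nonneg.2 a1) (sub_nonneg.2 b1)]
  have hB : |t - a * b| ≤ min b (1 - b) := by
    rw [le_min_iff, abs_le, abs_le]
    refine ⟨⟨?_, ?_⟩, ?_, ?_⟩ <;> nlinarith [mul_nonneg a0 b0, mul_nonneg a0 (sub_nonneg.2 b1),
      mul_nonneg b0 (sub_nonneg.2 a1), mul_nonneg (sub_nonneg.2 a1) (sub_nonneg.2 b1)]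
  calc |t - a * b| = √|t - a * b| * √|t - a * b| := (Real.mul_self_sqrt (abs_nonneg _)).symm
    _ ≤ _ := mul_le_mul (Real.sqrt_le_sqrt hA) (Real.sqrt_le_sqrt hB) (Real.sqrt_nonneg _)
        (Real.sqrt_nonneg _)

noncomputable def Lv (pi : V → ℝ) (p : V → V → ℝ) (x : V) (n : ℕ) : ℝ :=
  (∫ S, sh pi S ∂(esM pi p x n)) / pi x

lemma Lv_nonneg (h : Chain pi p) (x : V) (n : ℕ) : 0 ≤ Lv pi p x n :=
  div_nonneg (integral_nonneg fun S => sh_nonneg S) (h.pos x).le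

lemma dev [Countable V] (h : Chain pi p) (x z : V) (n m : ℕ) :
    |pn p (n + m) x z / pi z - 1| ≤ Lv pi p x n * Lv pi (rev pi p) z m := by
  have hx := h.pos x
  have hz := h.pos z
  set μ := esM pi p x n
  set ν := esM pi (rev pi p) z m
  have mi : Measurable (fun q : Set V × Set V => piS pi (q.1 ∩ q.2)) := by
    simp_rw [piS_eq, ind_inter]
    exact Measurable.tsum fun y => (((measurable_ind y).comp measurable_fst).mul
      ((measurable_ind y).comp measurable_snd)).const_mul _
  have e1 : ∫ q, piS pi (q.1 ∩ q.2) ∂(μ.prod ν) = pi x * pn p (n + m) x z := by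
    rw [← h.conv x z m n]
    simp_rw [piS_eq, ind_inter]
    rw [swap_sum (μ.prod ν) pi (fun y => (h.pos y).le) h.pi1.summable
      (fun y q => ind q.1 y * ind q.2 y)
      (fun y => ((measurable_ind y).comp measurable_fst).mul
        ((measurable_ind y).comp measurable_snd))
      (fun y q => mul_nonneg (ind_nonneg _ _) (ind_nonneg _ _))
      (fun y q => mul_le_one₀ (ind_le_one _ _) (ind_nonneg _ _) (ind_le_one _ _))]
    congr 1; ext y
    rw [integral_prod_mul (fun S => ind S y) (fun S => ind S y)]
    rfl
  have e2 : ∫ q, piS pi q.1 * piS pi q.2 ∂(μ.prod ν) = pi x * pi z := by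
    rw [integral_prod_mul, h.mass, h.isRev.mass]
  have e3 : ∫ q, sh pi q.1 * sh pi q.2 ∂(μ.prod ν) = (∫ S, sh pi S ∂μ) * ∫ S, sh pi S ∂ν :=
    integral_prod_mul _ _
  have i1 : Integrable (fun q : Set V × Set V => piS pi (q.1 ∩ q.2)) (μ.prod ν) :=
    Integrable.of_mem_Icc 0 1 mi.aemeasurable
      (ae_of_all _ fun _ => ⟨h.piS_nonneg _, h.piS_le_one _⟩)
  have i2 : Integrable (fun q : Set V × Set V => piS pi q.1 * piS pi q.2) (μ.prod ν) :=
    Integrable.of_mem_Icc 0 1 (((measurable_piS pi).comp measurable_fst).mul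
      ((measurable_piS pi).comp measurable_snd)).aemeasurable
      (ae_of_all _ fun _ => ⟨mul_nonneg (h.piS_nonneg _) (h.piS_nonneg _),
        mul_le_one₀ (h.piS_le_one _) (h.piS_nonneg _) (h.piS_le_one _)⟩)
  have i3 : Integrable (fun q : Set V × Set V => sh pi q.1 * sh pi q.2) (μ.prod ν) :=
    Integrable.of_mem_Icc 0 1 ((h.measurable_sh.comp measurable_fst).mul
      (h.measurable_sh.comp measurable_snd)).aemeasurable
      (ae_of_all _ fun _ => ⟨mul_nonneg (sh_nonneg _) (sh_nonneg _),
        mul_le_one₀ (h.sh_le_one _) (sh_nonneg _) (h.sh_le_one _)⟩)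
  have main : |pi x * pn p (n + m) x z - pi x * pi z| ≤ (∫ S, sh pi S ∂μ) * ∫ S, sh pi S ∂ν := by
    rw [← e1, ← e2, ← e3, ← integral_sub i1 i2]
    refine (abs_integral_le_integral_abs).trans ?_
    exact integral_mono (i1.sub i2).abs i3 fun q => h.cov q.1 q.2
  have e4 : pn p (n + m) x z / pi z - 1 =
      (pi x * pn p (n + m) x z - pi x * pi z) / (pi x * pi z) := by
    field_simp
  rw [e4, abs_div, abs_of_pos (mul_pos hx hz), Lv, Lv, div_mul_div_comm]
  exact div_le_div_of_nonneg_right main (mul_pos hx hz).le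

lemma Lv_zero (h : Chain pi p) [Countable V] (x : V) : Lv pi p x 0 ^ 2 ≤ 1 / pi x := by
  have hx := h.pos x
  rw [Lv, esM, integral_dirac' _ _ h.measurable_sh.stronglyMeasurable, div_pow,
    sh, Real.sq_sqrt (h.piS_nonneg _), div_le_div_iff₀ (by positivity) hx]
  have : piS pi (sharp pi {x}) ≤ pi x := by
    rw [h.piS_sharp, piS_singleton]; exact min_le_left _ _
  nlinarith

lemma integrable_sh [Countable V] (h : Chain pi p) (x : V) (n : ℕ) :
    Integrable (sh pi) (esM pi p x n) :=
  integrable_esM x n h.measurable_sh sh_nonneg h.sh_le_one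

lemma Lv_anti [Countable V] (h : Chain pi p) (x : V) (n : ℕ) :
    Lv pi p x (n+1) ≤ Lv pi p x n := by
  unfold Lv
  refine div_le_div_of_nonneg_right ?_ (h.pos x).le
  obtain ⟨hi, he⟩ := esM_succ (pi := pi) (p := p) x n h.measurable_sh sh_nonneg h.sh_le_one
  rw [he]
  refine integral_mono hi (h.integrable_sh x n) fun S => ?_
  refine (h.key_sharp S).trans ?_
  have := sh_nonneg (pi := pi) S
  nlinarith [mul_nonneg this (sq_nonneg (cond pi p (sharp pi S)))]

lemma Lv_step [Countable V] (h : Chain pi p) (x : V) (n : ℕ) (hL : 0 < Lv pi p x n) :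
    Lv pi p x (n+1) ≤ Lv pi p x n * (1 - profile pi p (4 / Lv pi p x n ^ 2) ^ 2 / 4) := by
  have hx := h.pos x
  obtain ⟨hi, he⟩ := esM_succ (pi := pi) (p := p) x n h.measurable_sh sh_nonneg h.sh_le_one
  have hLe : ∫ S, sh pi S ∂(esM pi p x n) = Lv pi p x n * pi x := by
    rw [Lv, div_mul_cancel₀ _ hx.ne']
  set L := Lv pi p x n with hLd
  set F := profile pi p (4 / L ^ 2) with hF
  have hF0 : 0 ≤ F := h.profile_nonneg _
  have pt : ∀ S, ∫ u in Ioc (0:ℝ) 1, sh pi (esStep pi p S u) ≤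
      sh pi S - F ^ 2 / 2 * (sh pi S - L / 2 * piS pi S) := by
    intro S
    refine (h.key_sharp S).trans ?_
    have s0 := sh_nonneg (pi := pi) S
    have P0 := h.piS_nonneg S
    have c0 := h.cond_nonneg (sharp pi S)
    by_cases hA : L / 2 * piS pi S < sh pi S
    · have spos : 0 < sh pi S := lt_of_le_of_lt (by positivity) hA
      have hsq : sh pi S ^ 2 = piS pi (sharp pi S) := Real.sq_sqrt (h.piS_nonneg _)
      have hpos : 0 < piS pi (sharp pi S) := by rw [← hsq]; positivity
      have hle : piS pi (sharp pi S) ≤ piS pi S := by rw [h.piS_sharp]; exact min_le_left _ _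
      have hr : piS pi (sharp pi S) ≤ 4 / L ^ 2 := by
        have h1 : L / 2 * sh pi S ^ 2 ≤ sh pi S := by
          rw [hsq]
          exact (mul_le_mul_of_nonneg_left hle (by positivity)).trans hA.le
        have h2 : L / 2 * sh pi S ≤ 1 := by
          by_contra hc
          push Not at hc
          nlinarith
        rw [le_div_iff₀ (by positivity), ← hsq]
        have h3 : 0 ≤ L / 2 * sh pi S := by positivity
        nlinarith
      have hc := h.profile_le hpos hr (h.sharp_le_half S)
      have hc2 : F ^ 2 ≤ cond pi p (sharp pi S) ^ 2 := pow_le_pow_left₀ hF0 hc 2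
      have h5 : 0 ≤ L / 2 * piS pi S := by positivity
      nlinarith [mul_le_mul_of_nonneg_left hc2 s0, mul_nonneg (sq_nonneg F) h5]
    · push Not at hA
      nlinarith [mul_nonneg s0 (sq_nonneg (cond pi p (sharp pi S))),
        mul_nonneg (sq_nonneg F) (sub_nonneg.2 hA)]
  have ip : Integrable (piS pi) (esM pi p x n) :=
    integrable_esM x n (measurable_piS pi) h.piS_nonneg h.piS_le_one
  have is := h.integrable_sh x n
  have i2 : Integrable (fun S => F ^ 2 / 2 * (sh pi S - L / 2 * piS pi S)) (esM pi p x n) :=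
    (is.sub (ip.const_mul (L / 2))).const_mul (F ^ 2 / 2)
  have := integral_mono hi (is.sub i2) pt
  rw [← he] at this
  have e : ∫ S, (sh pi S - F ^ 2 / 2 * (sh pi S - L / 2 * piS pi S)) ∂(esM pi p x n) =
      L * (1 - F ^ 2 / 4) * pi x := by
    rw [integral_sub is i2, integral_const_mul, integral_sub is (ip.const_mul _),
      integral_const_mul, h.mass, hLe]
    ring
  rw [Lv, div_le_iff₀ hx]
  exact this.trans e.le

lemma prod_bound [Countable V] (h : Chain pi p) (x w : V) (hw : pi w ≤ pi x) {ε : ℝ} (hε : 0 < ε)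
    (n : ℕ) (hn : (∫⁻ u in Ioc (4 * pi w) (4 / ε),
      4 / ENNReal.ofReal (u * profile pi p u ^ 2)) ≤ (n : ℝ≥0∞)) :
    Lv pi p x (n / 2) * Lv pi p x ((n + 1) / 2) ≤ ε := by
  have hwp := h.pos w
  have hanti : Antitone (Lv pi p x) := antitone_nat_of_succ_le (h.Lv_anti x)
  have L0 := h.Lv_nonneg x
  have e2 : ∀ k, (k + 1 + 1) / 2 = k / 2 + 1 := fun k => by omega
  have hpa : ∀ r s, 4 * pi w ≤ r → r ≤ s → profile pi p s ≤ profile pi p r :=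
    fun r s hr hrs => h.profile_anti w (by linarith) hrs
  refine ode (profile pi p) h.profile_nonneg (v0 := 4 * pi w) (by linarith) hpa
    (fun k => Lv pi p x (k / 2) * Lv pi p x ((k + 1) / 2)) ?_ ?_ ?_ hε n hn
  · have h1 := h.Lv_zero x
    have h2 : 1 / pi x ≤ 1 / pi w := one_div_le_one_div_of_le hwp hw
    have h3 : (4:ℝ) / (4 * pi w) = 1 / pi w := by field_simp
    simp only [h3, Nat.zero_div, zero_add, Nat.reduceDiv]
    nlinarith
  · intro k hk hv
    simp only [e2] at hk hv ⊢
    have hj : 0 < Lv pi p x (k / 2) := by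
      refine lt_of_le_of_ne (L0 _) fun h0 => ?_
      rw [← h0, zero_mul] at hk; exact lt_irrefl _ hk
    have hs := h.Lv_step x (k / 2) hj
    set A := Lv pi p x (k / 2)
    set B := Lv pi p x ((k + 1) / 2)
    have hBA : B ≤ A := hanti (by omega)
    have hAB : 4 / A ^ 2 ≤ 4 / (A * B) :=
      div_le_div_of_nonneg_left (by norm_num) hk (by nlinarith)
    have hA0 : A ^ 2 ≤ 1 / pi w := by
      have h1 := h.Lv_zero x
      have h2 : 1 / pi x ≤ 1 / pi w := one_div_le_one_div_of_le hwp hw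
      have h3 : A ≤ Lv pi p x 0 := hanti (Nat.zero_le _)
      exact (pow_le_pow_left₀ hj.le h3 2).trans (h1.trans h2)
    have hA1 : 4 * pi w ≤ 4 / A ^ 2 := by
      rw [le_div_iff₀ (by positivity)]
      rw [le_div_iff₀ hwp] at hA0
      nlinarith
    have hm := hpa _ _ hA1 hAB
    have hm2 := pow_le_pow_left₀ (h.profile_nonneg _) hm 2
    set G := profile pi p (4 / (A * B)) ^ 2
    have hexp : 1 - profile pi p (4 / A ^ 2) ^ 2 / 4 ≤ Real.exp (-(G / 4)) := by
      have := Real.add_one_le_exp (-(G / 4))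
      linarith
    have hB0 : 0 ≤ B := L0 _
    calc B * Lv pi p x (k / 2 + 1) ≤ B * (A * Real.exp (-(G / 4))) :=
          mul_le_mul_of_nonneg_left (hs.trans (mul_le_mul_of_nonneg_left hexp hj.le)) hB0
      _ = _ := by ring
  · intro k
    simp only [e2]
    rw [mul_comm]
    exact mul_le_mul_of_nonneg_right (h.Lv_anti x _) (L0 _)

lemma core [Countable V] (h : Chain pi p) (x y : V) {ε : ℝ} (hε : 0 < ε) (n : ℕ)
    (hn : (∫⁻ u in Ioc (4 * min (pi x) (pi y)) (4 / ε),
      4 / ENNReal.ofReal (u * profile pi p u ^ 2)) ≤ (n : ℝ≥0∞)) :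
    |pn p n x y / pi y - 1| ≤ ε := by
  obtain ⟨w, hw⟩ : ∃ w, pi w = min (pi x) (pi y) := by
    rcases min_choice (pi x) (pi y) with h' | h'
    · exact ⟨x, h'.symm⟩
    · exact ⟨y, h'.symm⟩
  rw [← hw] at hn
  have b1 := h.prod_bound x w (hw ▸ min_le_left _ _) hε n hn
  have b2 := h.isRev.prod_bound y w (hw ▸ min_le_right _ _) hε n (by rw [h.profile_rev]; exact hn)
  have d1 := h.dev x y (n / 2) ((n + 1) / 2)
  have d2 := h.dev x y ((n + 1) / 2) (n / 2)
  rw [show n / 2 + (n + 1) / 2 = n by omega] at d1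
  rw [show (n + 1) / 2 + n / 2 = n by omega] at d2
  have l1 := h.Lv_nonneg x (n / 2)
  have l2 := h.Lv_nonneg x ((n + 1) / 2)
  have l3 := h.isRev.Lv_nonneg y (n / 2)
  have l4 := h.isRev.Lv_nonneg y ((n + 1) / 2)
  have a0 := abs_nonneg (pn p n x y / pi y - 1)
  refine (sq_le_sq₀ a0 hε.le).1 ?_
  calc |pn p n x y / pi y - 1| ^ 2 = |pn p n x y / pi y - 1| * |pn p n x y / pi y - 1| := by ring
    _ ≤ (Lv pi p x (n / 2) * Lv pi (rev pi p) y ((n + 1) / 2)) *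
        (Lv pi p x ((n + 1) / 2) * Lv pi (rev pi p) y (n / 2)) :=
        mul_le_mul d1 d2 a0 (mul_nonneg l1 l4)
    _ = (Lv pi p x (n / 2) * Lv pi p x ((n + 1) / 2)) *
        (Lv pi (rev pi p) y (n / 2) * Lv pi (rev pi p) y ((n + 1) / 2)) := by ring
    _ ≤ ε * ε := mul_le_mul b1 b2 (mul_nonneg l3 l4) hε.le
    _ = ε ^ 2 := by ring

end Chain

/-- Theorem 1 (finite case): uniform mixing bound from the conductance profile,
under the laziness assumption `p(x,x) ≥ 1/2`. -/
theorem uniform_mixing_from_conductance [Countable V] [Nonempty V]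
    (p : V → V → ℝ) (pi : V → ℝ)
    (hp0 : ∀ x y, 0 ≤ p x y) (hp1 : ∀ x, ∑' y, p x y = 1)
    (hpipos : ∀ x, 0 < pi x) (hpi1 : ∑' x, pi x = 1)
    (hstat : ∀ y, ∑' x, pi x * p x y = pi y)
    (hirr : ∀ x y : V, ∃ n, 0 < pn p n x y)
    (hlazy : ∀ x, (1 : ℝ) / 2 ≤ p x x)
    (ε : ℝ) (hε : 0 < ε) :
    (∀ (x y : V) (n : ℕ),
        1 + (∫⁻ u in Ioc (4 * min (pi x) (pi y)) (4 / ε),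
              4 / ENNReal.ofReal (u * profile pi p u ^ 2)) ≤ (n : ℝ≥0∞) →
        |pn p n x y / pi y - 1| ≤ ε) ∧
      ((sInf {n : ℕ | ∀ x y : V, |pn p n x y / pi y - 1| ≤ ε} : ℕ) : ℝ≥0∞) ≤
        1 + ∫⁻ u in Ioc (4 * sInf (range pi)) (4 / ε),
              4 / ENNReal.ofReal (u * profile pi p u ^ 2) := by
  have hsum : ∀ {f : V → ℝ} {a : ℝ}, a ≠ 0 → ∑' x, f x = a → HasSum f a := by
    intro f a ha hf
    have : Summable f := by
      by_contra hc
      exact ha (hf ▸ tsum_eq_zero_of_not_summable hc)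
    exact hf ▸ this.hasSum
  have h : Chain pi p :=
    ⟨hp0, fun x => hsum one_ne_zero (hp1 x), hpipos, hsum one_ne_zero hpi1,
      fun y => hsum (hpipos y).ne' (hstat y), hlazy⟩
  refine ⟨fun x y n hn => h.core x y hε n (le_add_self.trans hn), ?_⟩
  set I := ∫⁻ u in Ioc (4 * sInf (range pi)) (4 / ε),
    4 / ENNReal.ofReal (u * profile pi p u ^ 2) with hI
  by_cases hT : I = ⊤
  · rw [hT]; simp
  · have hle : I ≤ (⌈I.toReal⌉₊ : ℝ≥0∞) := by
      rw [← ENNReal.ofReal_toReal hT, ← ENNReal.ofReal_natCast]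
      refine ENNReal.ofReal_le_ofReal ?_
      rw [ENNReal.toReal_ofReal ENNReal.toReal_nonneg]
      exact Nat.le_ceil _
    have hmem : ⌈I.toReal⌉₊ ∈ {n : ℕ | ∀ x y : V, |pn p n x y / pi y - 1| ≤ ε} := by
      intro x y
      refine h.core x y hε _ (le_trans ?_ hle)
      refine lintegral_mono_set (Ioc_subset_Ioc_left ?_)
      have hb : BddBelow (range pi) := ⟨0, by rintro _ ⟨z, rfl⟩; exact (hpipos z).le⟩
      have := csInf_le hb ⟨x, rfl⟩
      have := csInf_le hb ⟨y, rfl⟩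
      have : sInf (range pi) ≤ min (pi x) (pi y) := le_min (by assumption) (by assumption)
      linarith
    have hmin := Nat.sInf_le hmem
    refine (Nat.cast_le.2 hmin).trans ?_
    rw [← ENNReal.ofReal_natCast]
    refine (ENNReal.ofReal_le_ofReal (Nat.ceil_lt_add_one ENNReal.toReal_nonneg).le).trans ?_
    rw [ENNReal.ofReal_add ENNReal.toReal_nonneg zero_le_one, ENNReal.ofReal_toReal hT, add_comm]
    simp

end EvolvingSetsPaper
end

section
/- Suppose 0 < γ ≤ 1/2 and p(x,x) ≥ γ for all x ∈ V. Then for every ε > 0 and all x, y ∈ V, if n ≥ 1 + ((1−γ)²/γ²) ∫_{4(π(x) ∧ π(y))}^{4/ε} (4/(u Φ(u)²)) du, then |p^n(x,y)/π(y) − 1| ≤ ε. -/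
open MeasureTheory Set
open scoped ENNReal Classical

namespace EvolvingSetsPaper

variable {V : Type*}

structure Ch (p : V → V → ℝ) (pi : V → ℝ) (γ : ℝ) : Prop where
  p0 : ∀ x y, 0 ≤ p x y
  p1 : ∀ x, HasSum (p x) 1
  pos : ∀ x, 0 < pi x
  pi1 : HasSum pi 1
  st : ∀ y, HasSum (fun x => pi x * p x y) (pi y)
  g0 : 0 < γ
  g1 : γ ≤ 1 / 2
  lazy : ∀ x, γ ≤ p x x

section basics
variable {p : V → V → ℝ} {pi : V → ℝ} {γ : ℝ}

lemma Ch.hasSum_piS (h : Ch p pi γ) (S : Set V) : HasSum (S.indicator pi) (piS pi S) := by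
  unfold piS
  rw [tsum_subtype]
  exact (h.pi1.summable.indicator S).hasSum

lemma Ch.piS_nonneg (h : Ch p pi γ) (S : Set V) : 0 ≤ piS pi S :=
  tsum_nonneg fun y => (h.pos y).le

lemma Ch.piS_mono (h : Ch p pi γ) {S T : Set V} (hST : S ⊆ T) : piS pi S ≤ piS pi T :=
  hasSum_le (fun y => Set.indicator_le_indicator_of_subset hST (fun a => (h.pos a).le) y)
    (h.hasSum_piS S) (h.hasSum_piS T)

lemma Ch.piS_compl (h : Ch p pi γ) (S : Set V) : piS pi Sᶜ = 1 - piS pi S := by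
  have := (h.hasSum_piS S).add (h.hasSum_piS Sᶜ)
  have h2 : (fun y => S.indicator pi y + Sᶜ.indicator pi y) = pi := by
    funext y; exact congrFun (Set.indicator_self_add_compl S pi) y
  rw [h2] at this
  linarith [this.unique h.pi1]

lemma Ch.piS_le_one (h : Ch p pi γ) (S : Set V) : piS pi S ≤ 1 := by
  have := h.piS_nonneg Sᶜ
  rw [h.piS_compl] at this; linarith

lemma piS_singleton (x : V) : piS pi {x} = pi x := by
  unfold piS; simp

lemma piS_univ (h : Ch p pi γ) : piS pi univ = 1 := by
  have := h.hasSum_piS univ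
  simp only [indicator_univ] at this
  exact this.unique h.pi1

lemma piS_empty : piS pi (∅ : Set V) = 0 := by
  unfold piS; simp

lemma Ch.q0 (h : Ch p pi γ) (x y : V) : 0 ≤ pi x * p x y := mul_nonneg (h.pos x).le (h.p0 x y)

lemma Ch.hasSum_QS (h : Ch p pi γ) (S : Set V) (y : V) :
    HasSum (S.indicator (fun s => pi s * p s y)) (QS pi p S y) := by
  unfold QS
  rw [tsum_subtype S (fun s => pi s * p s y)]
  exact ((h.st y).summable.indicator S).hasSum

lemma Ch.QS_nonneg (h : Ch p pi γ) (S : Set V) (y : V) : 0 ≤ QS pi p S y :=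
  tsum_nonneg fun s => h.q0 s y

lemma Ch.QS_compl (h : Ch p pi γ) (S : Set V) (y : V) : QS pi p S y + QS pi p Sᶜ y = pi y := by
  have := (h.hasSum_QS S y).add (h.hasSum_QS Sᶜ y)
  have h2 : (fun z => S.indicator (fun s => pi s * p s y) z +
      Sᶜ.indicator (fun s => pi s * p s y) z) = (fun s => pi s * p s y) := by
    funext z; exact congrFun (Set.indicator_self_add_compl S _) z
  rw [h2] at this
  exact this.unique (h.st y)

lemma Ch.QS_ge (h : Ch p pi γ) {S : Set V} {y : V} (hy : y ∈ S) : γ * pi y ≤ QS pi p S y := by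
  have := le_hasSum (h.hasSum_QS S y) y
    (fun z _ => Set.indicator_nonneg (fun s _ => h.q0 s y) z)
  rw [Set.indicator_of_mem hy] at this
  nlinarith [h.lazy y, h.pos y]

lemma Ch.QS_le (h : Ch p pi γ) {S : Set V} {y : V} (hy : y ∉ S) :
    QS pi p S y ≤ (1 - γ) * pi y := by
  have := h.QS_ge (S := Sᶜ) hy
  have := h.QS_compl S y
  linarith

lemma Ch.QS_le_pi (h : Ch p pi γ) (S : Set V) (y : V) : QS pi p S y ≤ pi y := by
  have := h.QS_nonneg Sᶜ y
  have := h.QS_compl S y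
  linarith

lemma Ch.summable_QS (h : Ch p pi γ) (S : Set V) : Summable (QS pi p S) :=
  Summable.of_nonneg_of_le (h.QS_nonneg S) (h.QS_le_pi S) h.pi1.summable

lemma Ch.summable2 (h : Ch p pi γ) :
    Summable (fun z : V × V => pi z.1 * p z.1 z.2) := by
  refine (summable_prod_of_nonneg (f := fun z : V × V => pi z.1 * p z.1 z.2) (fun z => h.q0 z.1 z.2)).2 ?_
  have e : ∀ x, HasSum (fun y => pi x * p x y) (pi x) := fun x => by
    simpa using (h.p1 x).mul_left (pi x)
  refine ⟨fun x => (e x).summable, ?_⟩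
  have e2 : (fun x => ∑' y, pi x * p x y) = pi := funext fun x => (e x).tsum_eq
  rw [e2]
  exact h.pi1.summable

lemma Ch.summable3 (h : Ch p pi γ) (S A : Set V) :
    Summable (fun z : V × V => S.indicator (fun _ => A.indicator (fun a => pi z.1 * p z.1 a) z.2) z.1) := by
  refine Summable.of_nonneg_of_le (fun z => ?_) (fun z => ?_) h.summable2
  · exact Set.indicator_nonneg (fun _ _ => Set.indicator_nonneg (fun a _ => h.q0 _ _) _) _
  · by_cases h1 : z.1 ∈ S <;> by_cases h2 : z.2 ∈ A <;> simp [h1, h2, h.q0 z.1 z.2]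

lemma Ch.hasSum_QSy (h : Ch p pi γ) (S : Set V) : HasSum (QS pi p S) (piS pi S) := by
  have hs := h.summable3 S univ
  have := Summable.tsum_comm (f := fun s a => S.indicator (fun _ => (univ : Set V).indicator (fun a => pi s * p s a) a) s) hs
  rw [(h.summable_QS S).hasSum_iff]
  have e1 : ∀ y, QS pi p S y = ∑' s, S.indicator (fun _ => (univ : Set V).indicator (fun a => pi s * p s a) y) s := by
    intro y
    rw [← (h.hasSum_QS S y).tsum_eq]
    congr 1; funext s
    by_cases hs : s ∈ S <;> simp [hs]
  simp_rw [e1]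
  rw [this, ← (h.hasSum_piS S).tsum_eq]
  congr 1; funext s
  by_cases hs : s ∈ S <;> simp [hs, tsum_mul_left, (h.p1 _).tsum_eq]

lemma Ch.Qset_eq (h : Ch p pi γ) (S A : Set V) :
    HasSum (A.indicator (QS pi p S)) (Qset pi p S A) := by
  unfold Qset
  rw [tsum_subtype A (QS pi p S)]
  exact ((h.summable_QS S).indicator A).hasSum

lemma Ch.Qset_nonneg (h : Ch p pi γ) (S A : Set V) : 0 ≤ Qset pi p S A :=
  tsum_nonneg fun y => h.QS_nonneg S y

lemma Ch.Qset_add (h : Ch p pi γ) (S : Set V) :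
    Qset pi p S S + Qset pi p S Sᶜ = piS pi S := by
  have := (h.Qset_eq S S).add (h.Qset_eq S Sᶜ)
  have h2 : (fun y => S.indicator (QS pi p S) y + Sᶜ.indicator (QS pi p S) y) = QS pi p S := by
    funext y; exact congrFun (Set.indicator_self_add_compl S _) y
  rw [h2] at this
  exact this.unique (h.hasSum_QSy S)

/-- time reversal -/
noncomputable def rev (p : V → V → ℝ) (pi : V → ℝ) (x y : V) : ℝ := pi y * p y x / pi x

lemma Ch.pi_rev (h : Ch p pi γ) (x y : V) : pi x * rev p pi x y = pi y * p y x := by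
  unfold rev; have := (h.pos x).ne'; field_simp

lemma Ch.rev (h : Ch p pi γ) : Ch (rev p pi) pi γ where
  p0 x y := div_nonneg (h.q0 y x) (h.pos x).le
  p1 x := by
    have := (h.st x).div_const (pi x)
    rwa [div_self (h.pos x).ne'] at this
  pos := h.pos
  pi1 := h.pi1
  st y := by
    simp only [h.pi_rev]
    simpa using (h.p1 y).mul_left (pi y)
  g0 := h.g0
  g1 := h.g1
  lazy x := by
    have := h.pi_rev x x
    have h2 := mul_left_cancel₀ (h.pos x).ne' this
    rw [h2]; exact h.lazy x

lemma Ch.Qset_rev_self (h : Ch p pi γ) (S : Set V) :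
    Qset pi (EvolvingSetsPaper.rev p pi) S S = Qset pi p S S := by
  rw [← (h.Qset_eq S S).tsum_eq, ← (h.rev.Qset_eq S S).tsum_eq]
  have := Summable.tsum_comm (f := fun s a => S.indicator (fun _ => S.indicator (fun a => pi s * p s a) a) s) (h.summable3 S S)
  calc _ = ∑' (b : V) (c : V), S.indicator (fun _ => S.indicator (fun a => pi b * p b a) c) b := by
        congr 1; funext b
        by_cases hb : b ∈ S
        · simp only [hb, indicator_of_mem]
          rw [← (h.rev.hasSum_QS S b).tsum_eq]
          simp only [h.pi_rev]
        · simp [hb]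
    _ = _ := by
        rw [← this]
        congr 1; funext b
        by_cases hb : b ∈ S
        · simp only [hb, indicator_of_mem]
          rw [← (h.hasSum_QS S b).tsum_eq]
          congr 1
        · simp [hb]

lemma Ch.cond_rev (h : Ch p pi γ) (S : Set V) :
    cond pi (EvolvingSetsPaper.rev p pi) S = cond pi p S := by
  unfold cond
  have h1 := h.Qset_add S
  have h2 := h.rev.Qset_add S
  rw [h.Qset_rev_self] at h2
  congr 1; linarith

lemma Ch.profile_rev (h : Ch p pi γ) : profile pi (EvolvingSetsPaper.rev p pi) = profile pi p := by
  have : cond pi (EvolvingSetsPaper.rev p pi) = cond pi p := funext h.cond_rev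
  unfold profile
  rw [this]

lemma Ch.cond_nonneg (h : Ch p pi γ) (S : Set V) : 0 ≤ cond pi p S :=
  div_nonneg (h.Qset_nonneg _ _) (h.piS_nonneg _)

lemma Ch.bdd (h : Ch p pi γ) (A : Set (Set V)) : BddBelow (cond pi p '' A) :=
  ⟨0, by rintro _ ⟨S, _, rfl⟩; exact h.cond_nonneg S⟩

lemma Ch.profile_le (h : Ch p pi γ) {S : Set V} {r : ℝ} (h0 : 0 < piS pi S) (hr : piS pi S ≤ r)
    (h2 : piS pi S ≤ 1 / 2) : profile pi p r ≤ cond pi p S := by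
  unfold profile
  split_ifs
  · exact csInf_le (h.bdd _) ⟨S, ⟨h0, hr⟩, rfl⟩
  · exact csInf_le (h.bdd _) ⟨S, ⟨h0, h2⟩, rfl⟩

lemma Ch.profile_nonneg (h : Ch p pi γ) (r : ℝ) : 0 ≤ profile pi p r := by
  unfold profile
  split_ifs <;> exact Real.sInf_nonneg (by rintro _ ⟨S, _, rfl⟩; exact h.cond_nonneg S)

lemma Ch.profile_anti (h : Ch p pi γ) [Nontrivial V] {x : V} {r s : ℝ} (hr : pi x ≤ r)
    (hrs : r ≤ s) : profile pi p s ≤ profile pi p r := by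
  by_cases h1 : r ≤ 1 / 2
  · conv_rhs => unfold profile
    rw [if_pos h1]
    refine le_csInf ?_ ?_
    · exact ⟨_, {x}, by rw [mem_ofPred_eq, piS_singleton]; exact ⟨h.pos x, hr⟩, rfl⟩
    · rintro _ ⟨S, hS, rfl⟩
      exact h.profile_le hS.1 (hS.2.trans hrs) (hS.2.trans h1)
  · conv_rhs => unfold profile
    rw [if_neg h1]
    push Not at h1
    refine le_csInf ?_ ?_
    · obtain ⟨a, b, hab⟩ := exists_pair_ne V
      have hle : pi a + pi b ≤ 1 := by
        have := h.piS_mono (S := {b}) (T := {a}ᶜ) (by simpa using hab)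
        rw [h.piS_compl, piS_singleton, piS_singleton] at this
        linarith
      rcases le_total (pi a) (1/2) with ha | ha
      · exact ⟨_, {a}, by rw [mem_ofPred_eq, piS_singleton]; exact ⟨h.pos a, ha⟩, rfl⟩
      · exact ⟨_, {b}, by rw [mem_ofPred_eq, piS_singleton]; exact ⟨h.pos b, by linarith⟩, rfl⟩
    · rintro _ ⟨S, hS, rfl⟩
      exact h.profile_le hS.1 (by have := hS.2; linarith) hS.2

end basics

lemma le_of_sq_le_sq_aux {a b : ℝ} (h : a ^ 2 ≤ b ^ 2) (hb : 0 ≤ b) : a ≤ b :=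
  le_trans (le_abs_self a) (abs_le_of_sq_le_sq h hb)

section step
variable {p : V → V → ℝ} {pi : V → ℝ} {γ : ℝ}

lemma Ch.h_anti (h : Ch p pi γ) (S : Set V) : Antitone (fun u => piS pi (esStep pi p S u)) := by
  intro u v huv
  apply h.piS_mono
  intro y hy
  have hy' : v * pi y ≤ QS pi p S y := hy
  show u * pi y ≤ QS pi p S y
  nlinarith [h.pos y]

lemma Ch.lint_ind (h : Ch p pi γ) (S : Set V) (y : V) {t : ℝ} (ht0 : 0 ≤ t) :
    ∫⁻ u in Ioc 0 t, ENNReal.ofReal ((esStep pi p S u).indicator pi y)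
      = ENNReal.ofReal (min (t * pi y) (QS pi p S y)) := by
  have hpos := h.pos y
  have e : ∀ u, ENNReal.ofReal ((esStep pi p S u).indicator pi y)
      = (Iic (QS pi p S y / pi y)).indicator (fun _ => ENNReal.ofReal (pi y)) u := by
    intro u
    have : (y ∈ esStep pi p S u) ↔ u ∈ Iic (QS pi p S y / pi y) := by
      rw [mem_Iic, le_div_iff₀ hpos]; rfl
    by_cases hu : y ∈ esStep pi p S u
    · rw [indicator_of_mem hu, indicator_of_mem (this.1 hu)]
    · rw [indicator_of_notMem hu, indicator_of_notMem (fun hh => hu (this.2 hh)), ENNReal.ofReal_zero]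
  simp_rw [e]
  rw [lintegral_indicator measurableSet_Iic, setLIntegral_const, Measure.restrict_apply measurableSet_Iic]
  have : Iic (QS pi p S y / pi y) ∩ Ioc 0 t = Ioc 0 (min t (QS pi p S y / pi y)) := by
    ext u; simp only [mem_inter_iff, mem_Iic, mem_Ioc, le_min_iff]; tauto
  rw [this, Real.volume_Ioc, sub_zero, ← ENNReal.ofReal_mul hpos.le]
  congr 1
  rw [mul_min_of_nonneg _ _ hpos.le]
  congr 1
  · ring
  · field_simp

lemma Ch.ofReal_piS (h : Ch p pi γ) (S : Set V) :
    ENNReal.ofReal (piS pi S) = ∑' y, ENNReal.ofReal (S.indicator pi y) := by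
  rw [← (h.hasSum_piS S).tsum_eq]
  exact ENNReal.ofReal_tsum_of_nonneg
    (fun y => Set.indicator_nonneg (fun a _ => (h.pos a).le) y) (h.hasSum_piS S).summable

lemma Ch.summable_min (h : Ch p pi γ) (S : Set V) {t : ℝ} (ht0 : 0 ≤ t) :
    Summable (fun y => min (t * pi y) (QS pi p S y)) :=
  Summable.of_nonneg_of_le
    (fun y => le_min (mul_nonneg ht0 (h.pos y).le) (h.QS_nonneg S y)) (fun y => min_le_right _ _)
    (h.summable_QS S)

lemma Ch.meas_step (h : Ch p pi γ) (S : Set V) :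
    Measurable (fun u => esStep pi p S u) := by
  rw [measurable_set_iff]
  intro y
  have : MeasurableSet {u : ℝ | u * pi y ≤ QS pi p S y} :=
    measurableSet_le (by fun_prop) (by fun_prop)
  exact measurableSet_setOfPred.1 this

lemma meas_ind (pi : V → ℝ) (y : V) : Measurable (fun S : Set V => S.indicator pi y) := by
  have : (fun S : Set V => S.indicator pi y) = fun S => if y ∈ S then pi y else 0 := by
    funext S; simp [indicator]
  rw [this]
  exact Measurable.ite (measurableSet_setOfPred.2 (measurable_set_mem y)) measurable_const measurable_const

lemma meas_piS [Countable V] (pi : V → ℝ) : Measurable (fun S : Set V => piS pi S) := by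
  have : (fun S : Set V => piS pi S) = fun S => ∑' y, S.indicator pi y := by
    funext S; exact tsum_subtype _ _
  rw [this]
  exact Measurable.tsum fun y => meas_ind pi y

lemma meas_QS [Countable V] (pi : V → ℝ) (p : V → V → ℝ) (y : V) :
    Measurable (fun S : Set V => QS pi p S y) :=
  meas_piS (fun s => pi s * p s y)

lemma Ch.lint_h [Countable V] (h : Ch p pi γ) (S : Set V) {t : ℝ} (ht0 : 0 ≤ t) :
    ∫⁻ u in Ioc 0 t, ENNReal.ofReal (piS pi (esStep pi p S u))
      = ENNReal.ofReal (∑' y, min (t * pi y) (QS pi p S y)) := by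
  simp_rw [h.ofReal_piS]
  rw [lintegral_tsum]
  · simp_rw [h.lint_ind S _ ht0]
    rw [ENNReal.ofReal_tsum_of_nonneg _ (h.summable_min S ht0)]
    exact fun y => le_min (mul_nonneg ht0 (h.pos y).le) (h.QS_nonneg S y)
  · intro y
    exact (((meas_ind pi y).comp (h.meas_step S)).ennreal_ofReal).aemeasurable

lemma Ch.int_h [Countable V] (h : Ch p pi γ) (S : Set V) {t : ℝ} (ht0 : 0 ≤ t) :
    ∫ u in (0:ℝ)..t, piS pi (esStep pi p S u) = ∑' y, min (t * pi y) (QS pi p S y) := by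
  rw [intervalIntegral.integral_of_le ht0, integral_eq_lintegral_of_nonneg_ae, h.lint_h S ht0,
    ENNReal.toReal_ofReal]
  · exact tsum_nonneg fun y => le_min (mul_nonneg ht0 (h.pos y).le) (h.QS_nonneg S y)
  · exact Filter.Eventually.of_forall fun u => h.piS_nonneg _
  · exact ((meas_piS pi).comp (h.meas_step S)).aestronglyMeasurable

lemma Ch.int_h_one [Countable V] (h : Ch p pi γ) (S : Set V) :
    ∫ u in (0:ℝ)..1, piS pi (esStep pi p S u) = piS pi S := by
  rw [h.int_h S zero_le_one, ← (h.hasSum_QSy S).tsum_eq]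
  congr 1; funext y
  rw [one_mul, min_eq_right (h.QS_le_pi S y)]

lemma Ch.int_h_gamma [Countable V] (h : Ch p pi γ) (S : Set V) :
    γ * (piS pi S + Qset pi p S Sᶜ / (1 - γ)) ≤ ∫ u in (0:ℝ)..γ, piS pi (esStep pi p S u) := by
  rw [h.int_h S h.g0.le]
  have hg : 0 < 1 - γ := by have := h.g1; linarith
  have h1 := (((h.hasSum_piS S).add ((h.Qset_eq S Sᶜ).div_const (1 - γ))).mul_left γ)
  refine hasSum_le (fun y => ?_) h1 (h.summable_min S h.g0.le).hasSum
  have hpos := h.pos y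
  by_cases hy : y ∈ S
  · simp only [hy, indicator_of_mem, mem_compl_iff, not_true_eq_false, not_false_eq_true,
      indicator_of_notMem, zero_div, add_zero]
    exact le_min le_rfl (h.QS_ge hy)
  · simp only [hy, indicator_of_mem, mem_compl_iff, not_false_eq_true,
      indicator_of_notMem, zero_add]
    have hq := h.QS_le hy
    have hq0 := h.QS_nonneg S y
    refine le_min ?_ ?_
    · apply mul_le_mul_of_nonneg_left _ h.g0.le
      rw [div_le_iff₀ hg]; linarith
    · rw [← mul_div_assoc, div_le_iff₀ hg]
      nlinarith [h.g1]

lemma cs_sqrt {f : ℝ → ℝ} (hf : Antitone f) (h0 : ∀ u, 0 ≤ f u) {a b : ℝ} (hab : a < b) :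
    (∫ u in a..b, √(f u)) ^ 2 ≤ (b - a) * ∫ u in a..b, f u := by
  have i1 : IntervalIntegrable f volume a b := (hf.antitoneOn _).intervalIntegrable
  have hs : Antitone (fun u => √(f u)) := fun u v huv => Real.sqrt_le_sqrt (hf huv)
  have i2 : IntervalIntegrable (fun u => √(f u)) volume a b := (hs.antitoneOn _).intervalIntegrable
  set X := ∫ u in a..b, √(f u)
  have hba : 0 < b - a := sub_pos.2 hab
  set m := X / (b - a) with hm
  have key : 0 ≤ ∫ u in a..b, (f u - 2 * m * √(f u) + m ^ 2) := by
    apply intervalIntegral.integral_nonneg hab.le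
    intro u _
    have := Real.sq_sqrt (h0 u)
    nlinarith [sq_nonneg (√(f u) - m)]
  rw [intervalIntegral.integral_add (i1.sub (i2.const_mul _)) (by simp),
    intervalIntegral.integral_sub i1 (i2.const_mul _), intervalIntegral.integral_const_mul,
    intervalIntegral.integral_const, smul_eq_mul] at key
  have hX : X = m * (b - a) := by rw [hm]; field_simp
  have : ∫ u in a..b, √(f u) = m * (b - a) := hX
  rw [this] at key
  rw [hX]
  nlinarith

lemma alg {γ s c A B X : ℝ} (hg0 : 0 < γ) (hg1 : γ ≤ 1 / 2) (hs : 0 < s) (hc : 0 ≤ c)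
    (hA : 0 ≤ A) (hB : 0 ≤ B)
    (h1 : γ * A ^ 2 + (1 - γ) * B ^ 2 = s) (h2 : s * (1 + c) ≤ A ^ 2)
    (hX : X = γ * A + (1 - γ) * B) : X ≤ √s * (1 - γ ^ 2 * c ^ 2 / 2) := by
  have hg : 0 < 1 - γ := by linarith
  have hgg : 0 < γ * (1 - γ) := mul_pos hg0 hg
  have d1 : s * c ≤ (1 - γ) * ((A - B) * (A + B)) := by nlinarith
  have d2 : γ * (1 - γ) * (A + B) ^ 2 ≤ s := by
    have : s - γ * (1 - γ) * (A + B) ^ 2 = (γ * A - (1 - γ) * B) ^ 2 := by rw [← h1]; ring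
    nlinarith [sq_nonneg (γ * A - (1 - γ) * B)]
  have d3 : (s * c) ^ 2 ≤ ((1 - γ) * ((A - B) * (A + B))) ^ 2 :=
    pow_le_pow_left₀ (by positivity) d1 2
  have d4 : γ * (s * c) ^ 2 ≤ (1 - γ) * (A - B) ^ 2 * s := by
    calc γ * (s * c) ^ 2 ≤ γ * ((1 - γ) * ((A - B) * (A + B))) ^ 2 :=
          mul_le_mul_of_nonneg_left d3 hg0.le
      _ = (1 - γ) * (A - B) ^ 2 * (γ * (1 - γ) * (A + B) ^ 2) := by ring
      _ ≤ _ := mul_le_mul_of_nonneg_left d2 (by positivity)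
  have d5 : γ * s * c ^ 2 ≤ (1 - γ) * (A - B) ^ 2 := by
    have : (γ * s * c ^ 2) * s ≤ (1 - γ) * (A - B) ^ 2 * s := by nlinarith
    exact le_of_mul_le_mul_right this hs
  have d6 : X ^ 2 ≤ s * (1 - γ ^ 2 * c ^ 2) := by
    have : X ^ 2 = s - γ * ((1 - γ) * (A - B) ^ 2) := by rw [hX, ← h1]; ring
    rw [this]
    nlinarith
  have hX0 : 0 ≤ X := by rw [hX]; positivity
  have hr : 0 ≤ 1 - γ ^ 2 * c ^ 2 := by
    by_contra hh
    push Not at hh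
    nlinarith [sq_nonneg X]
  have hss := Real.sq_sqrt hs.le
  apply le_of_sq_le_sq_aux _ (by have := Real.sqrt_nonneg s; apply mul_nonneg this; linarith)
  rw [mul_pow, hss]
  nlinarith [sq_nonneg (γ ^ 2 * c ^ 2)]

lemma alg2 {γ s Φ a b α β : ℝ} (hg0 : 0 < γ) (hg1 : γ ≤ 1 / 2) (hs : 0 < s) (hc : 0 ≤ Φ)
    (hb0 : 0 ≤ β) (h1 : α + β = s) (h2 : γ * (s + s * Φ / (1 - γ)) ≤ α)
    (ha : a ^ 2 ≤ γ * α) (hb : b ^ 2 ≤ (1 - γ) * β) :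
    a + b ≤ √s * (1 - γ ^ 2 / (2 * (1 - γ) ^ 2) * Φ ^ 2) := by
  have hg : 0 < 1 - γ := by linarith
  have ha0 : 0 ≤ α := le_trans (by positivity) h2
  have e1 : a ≤ γ * √(α / γ) := by
    apply le_of_sq_le_sq_aux _ (by positivity)
    rw [mul_pow, Real.sq_sqrt (by positivity)]
    calc _ ≤ _ := ha
      _ = _ := by field_simp
  have e2 : b ≤ (1 - γ) * √(β / (1 - γ)) := by
    apply le_of_sq_le_sq_aux _ (by positivity)
    rw [mul_pow, Real.sq_sqrt (by positivity)]
    calc _ ≤ _ := hb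
      _ = _ := by field_simp
  have := alg (γ := γ) (s := s) (c := Φ / (1 - γ)) (A := √(α / γ)) (B := √(β / (1 - γ))) hg0 hg1 hs
    (by positivity) (by positivity) (by positivity)
    (by rw [Real.sq_sqrt (by positivity), Real.sq_sqrt (by positivity)]; field_simp; linarith)
    (by rw [Real.sq_sqrt (by positivity), le_div_iff₀ hg0]
        calc _ = γ * (s + s * Φ / (1 - γ)) := by ring
          _ ≤ _ := h2) rfl
  calc a + b ≤ _ := add_le_add e1 e2
    _ ≤ _ := this
    _ = _ := by field_simp

lemma Ch.one_step [Countable V] (h : Ch p pi γ) (S : Set V) (hS : 0 < piS pi S) :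
    ∫ u in (0:ℝ)..1, √(piS pi (esStep pi p S u))
      ≤ √(piS pi S) * (1 - γ ^ 2 / (2 * (1 - γ) ^ 2) * cond pi p S ^ 2) := by
  have hg : 0 < 1 - γ := by have := h.g1; linarith
  have hf := h.h_anti S
  have hs : Antitone (fun u => √(piS pi (esStep pi p S u))) :=
    fun u v huv => Real.sqrt_le_sqrt (hf huv)
  have i1 : ∀ a b, IntervalIntegrable (fun u => piS pi (esStep pi p S u)) volume a b :=
    fun a b => (hf.antitoneOn _).intervalIntegrable
  have i2 : ∀ a b, IntervalIntegrable (fun u => √(piS pi (esStep pi p S u))) volume a b :=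
    fun a b => (hs.antitoneOn _).intervalIntegrable
  rw [← intervalIntegral.integral_add_adjacent_intervals (i2 0 γ) (i2 γ 1)]
  have t := h.int_h_one S
  rw [← intervalIntegral.integral_add_adjacent_intervals (i1 0 γ) (i1 γ 1)] at t
  refine alg2 h.g0 h.g1 hS (h.cond_nonneg S) ?_ t ?_ ?_ ?_
  · exact intervalIntegral.integral_nonneg (by linarith) fun u _ => h.piS_nonneg _
  · convert h.int_h_gamma S using 4
    unfold EvolvingSetsPaper.cond; field_simp
  · simpa using cs_sqrt hf (fun u => h.piS_nonneg _) h.g0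
  · exact cs_sqrt hf (fun u => h.piS_nonneg _) (by linarith)

/-- smaller of the masses of S and its complement -/
noncomputable def mm (pi : V → ℝ) (S : Set V) : ℝ := min (piS pi S) (1 - piS pi S)

lemma Ch.mm_nonneg (h : Ch p pi γ) (S : Set V) : 0 ≤ mm pi S :=
  le_min (h.piS_nonneg S) (by linarith [h.piS_le_one S])

lemma Ch.compl_step (h : Ch p pi γ) (S : Set V) (u : ℝ) :
    (esStep pi p S u)ᶜ ⊆ esStep pi p Sᶜ (1 - u) := by
  intro y hy
  have hy' : ¬ (u * pi y ≤ QS pi p S y) := hy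
  show (1 - u) * pi y ≤ QS pi p Sᶜ y
  have := h.QS_compl S y
  push Not at hy'
  linarith

lemma Ch.step_mm [Countable V] (h : Ch p pi γ) (S : Set V) (φ : ℝ) (hφ : 0 ≤ φ)
    (hS : 0 < mm pi S)
    (hc : ∀ T, piS pi T = mm pi S → φ ≤ cond pi p T) :
    ∫ u in (0:ℝ)..1, √(mm pi (esStep pi p S u))
      ≤ √(mm pi S) * (1 - γ ^ 2 / (2 * (1 - γ) ^ 2) * φ ^ 2) := by
  have hf := h.h_anti S
  have key : ∀ T, piS pi T = mm pi S →
      √(mm pi S) * (1 - γ ^ 2 / (2 * (1 - γ) ^ 2) * cond pi p T ^ 2) ≤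
      √(mm pi S) * (1 - γ ^ 2 / (2 * (1 - γ) ^ 2) * φ ^ 2) := by
    intro T hT
    have := hc T hT
    gcongr
  have hm : Measurable fun u => √(mm pi (esStep pi p S u)) := by
    have : Measurable fun u => piS pi (esStep pi p S u) := hf.measurable
    unfold mm
    fun_prop
  have im : IntervalIntegrable (fun u => √(mm pi (esStep pi p S u))) volume 0 1 := by
    rw [intervalIntegrable_iff]
    refine Measure.integrableOn_of_bounded (M := 1) (by simp) hm.aestronglyMeasurable ?_
    refine Filter.Eventually.of_forall fun u => ?_
    rw [Real.norm_eq_abs, abs_of_nonneg (Real.sqrt_nonneg _)]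
    exact Real.sqrt_le_one.2 ((min_le_left _ _).trans (h.piS_le_one _))
  have i2 : ∀ T a b, IntervalIntegrable (fun u => √(piS pi (esStep pi p T u))) volume a b :=
    fun T a b => (Antitone.antitoneOn (fun u v huv => Real.sqrt_le_sqrt (h.h_anti T huv)) _).intervalIntegrable
  rcases min_choice (piS pi S) (1 - piS pi S) with hh | hh
  · have e : piS pi S = mm pi S := hh.symm
    refine le_trans ?_ (key S e)
    rw [← e]
    refine le_trans ?_ (h.one_step S (e ▸ hS))
    exact intervalIntegral.integral_mono_on zero_le_one im (i2 _ _ _)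
      fun u _ => Real.sqrt_le_sqrt (min_le_left _ _)
  · have e : piS pi Sᶜ = mm pi S := by rw [h.piS_compl]; exact hh.symm
    refine le_trans ?_ (key Sᶜ e)
    rw [← e]
    refine le_trans ?_ (h.one_step Sᶜ (e ▸ hS))
    have := intervalIntegral.integral_comp_sub_left (a := 0) (b := 1)
      (fun u => √(piS pi (esStep pi p Sᶜ u))) 1
    rw [sub_self, sub_zero] at this
    rw [← this]
    refine intervalIntegral.integral_mono_on zero_le_one im ?_ ?_
    · have := (i2 Sᶜ 1 0).comp_sub_left 1
      simpa using this
    · intro u _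
      refine Real.sqrt_le_sqrt ((min_le_right _ _).trans ?_)
      rw [← h.piS_compl]
      exact h.piS_mono (h.compl_step S u)

lemma Ch.step_mm_zero [Countable V] (h : Ch p pi γ) (S : Set V) (hS : mm pi S = 0) :
    ∀ u ∈ Ioc (0:ℝ) 1, mm pi (esStep pi p S u) = 0 := by
  have em : ∀ T, piS pi T = 0 → T = ∅ := by
    intro T hT
    by_contra hne
    obtain ⟨y, hy⟩ := Set.nonempty_iff_ne_empty.2 hne
    have := h.piS_mono (S := {y}) (T := T) (by simpa using hy)
    rw [piS_singleton, hT] at this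
    exact absurd (h.pos y) (not_lt.2 this)
  intro u hu
  rcases min_choice (piS pi S) (1 - piS pi S) with hh | hh
  · have e : S = ∅ := em S (by rw [← hh]; exact hS)
    have : esStep pi p S u = ∅ := by
      ext y
      simp only [mem_empty_iff_false, iff_false]
      intro hy
      have hy' : u * pi y ≤ QS pi p S y := hy
      rw [e] at hy'
      have : QS pi p ∅ y = 0 := by unfold QS; simp
      nlinarith [h.pos y, hu.1, mul_pos hu.1 (h.pos y)]
    rw [this, mm, piS_empty]; simp
  · have e : Sᶜ = ∅ := em Sᶜ (by rw [h.piS_compl, ← hh]; exact hS)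
    have : esStep pi p S u = univ := by
      ext y
      simp only [mem_univ, iff_true]
      show u * pi y ≤ QS pi p S y
      have h1 := h.QS_compl S y
      rw [e] at h1
      have : QS pi p ∅ y = 0 := by unfold QS; simp
      nlinarith [h.pos y, hu.2]
    rw [this, mm, piS_univ h]; simp

end step

section process
variable {p : V → V → ℝ} {pi : V → ℝ} {γ : ℝ}

lemma Ch.pn_aux (h : Ch p pi γ) (n : ℕ) (x : V) :
    (∀ y, 0 ≤ pn p n x y) ∧ HasSum (pn p n x) 1 := by
  induction n with
  | zero =>
    refine ⟨fun y => ?_, ?_⟩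
    · simp only [pn]; split_ifs <;> norm_num
    · have := hasSum_ite_eq x (1:ℝ)
      simpa only [pn, eq_comm] using this
  | succ n ih =>
    obtain ⟨i0, i1⟩ := ih
    have t0 : ∀ z y, 0 ≤ pn p n x z * p z y := fun z y => mul_nonneg (i0 z) (h.p0 z y)
    refine ⟨fun y => tsum_nonneg fun z => t0 z y, ?_⟩
    have e : ∀ z, HasSum (fun y => pn p n x z * p z y) (pn p n x z) := fun z => by
      simpa using (h.p1 z).mul_left (pn p n x z)
    have s : Summable (fun w : V × V => pn p n x w.1 * p w.1 w.2) := by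
      refine (summable_prod_of_nonneg (f := fun w : V × V => pn p n x w.1 * p w.1 w.2)
        (fun w => t0 w.1 w.2)).2 ⟨fun z => (e z).summable, ?_⟩
      have e2 : (fun z => ∑' y, pn p n x z * p z y) = pn p n x := funext fun z => (e z).tsum_eq
      rw [e2]; exact i1.summable
    have s' : Summable (fun w : V × V => pn p n x w.2 * p w.2 w.1) := s.prod_symm
    have hs : Summable (fun y => ∑' z, pn p n x z * p z y) := s'.prod
    have := Summable.tsum_comm (f := fun z y => pn p n x z * p z y) s
    simp only [(e _).tsum_eq, i1.tsum_eq] at this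
    have h3 := hs.hasSum
    rw [this] at h3
    exact h3

lemma Ch.pn_nonneg (h : Ch p pi γ) (n : ℕ) (x y : V) : 0 ≤ pn p n x y := (h.pn_aux n x).1 y

lemma Ch.pn_sum (h : Ch p pi γ) (n : ℕ) (x : V) : HasSum (pn p n x) 1 := (h.pn_aux n x).2

lemma Ch.p_le_one (h : Ch p pi γ) (x y : V) : p x y ≤ 1 :=
  le_hasSum (h.p1 x) y fun z _ => h.p0 x z

lemma Ch.pn_succ_summable (h : Ch p pi γ) (n : ℕ) (x y : V) :
    Summable (fun z => pn p n x z * p z y) :=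
  Summable.of_nonneg_of_le (fun z => mul_nonneg (h.pn_nonneg n x z) (h.p0 z y))
    (fun z => mul_le_of_le_one_right (h.pn_nonneg n x z) (h.p_le_one z y)) (h.pn_sum n x).summable

lemma Ch.ofReal_pn_succ (h : Ch p pi γ) (n : ℕ) (x y : V) :
    ENNReal.ofReal (pn p (n + 1) x y) =
      ∑' z, ENNReal.ofReal (pn p n x z) * ENNReal.ofReal (p z y) := by
  have : pn p (n + 1) x y = ∑' z, pn p n x z * p z y := rfl
  rw [this, ENNReal.ofReal_tsum_of_nonneg (fun z => mul_nonneg (h.pn_nonneg n x z) (h.p0 z y))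
    (h.pn_succ_summable n x y)]
  congr 1; funext z
  rw [ENNReal.ofReal_mul (h.pn_nonneg n x z)]

/-- law of the evolving set process -/
noncomputable def law (pi : V → ℝ) (p : V → V → ℝ) (x : V) : ℕ → Measure (Set V)
  | 0 => Measure.dirac {x}
  | n + 1 => ((law pi p x n).prod (volume.restrict (Ioc (0:ℝ) 1))).map
      (fun z => esStep pi p z.1 z.2)

lemma meas_step2 [Countable V] : Measurable (fun z : Set V × ℝ => esStep pi p z.1 z.2) := by
  rw [measurable_set_iff]
  intro y
  have h1 : Measurable (fun z : Set V × ℝ => QS pi p z.1 y) := (meas_QS pi p y).comp measurable_fst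
  have : MeasurableSet {z : Set V × ℝ | z.2 * pi y ≤ QS pi p z.1 y} :=
    measurableSet_le (by fun_prop) h1
  exact measurableSet_setOfPred.1 this

lemma law_succ [Countable V] (x : V) (n : ℕ) {F : Set V → ℝ≥0∞} (hF : Measurable F) :
    ∫⁻ S, F S ∂(law pi p x (n + 1)) =
      ∫⁻ S, (∫⁻ u in Ioc (0:ℝ) 1, F (esStep pi p S u)) ∂(law pi p x n) := by
  rw [law, lintegral_map hF meas_step2, lintegral_prod]
  exact (hF.comp meas_step2).aemeasurable

lemma Ch.ofReal_QS (h : Ch p pi γ) (S : Set V) (y : V) :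
    ENNReal.ofReal (QS pi p S y) =
      ∑' z, ENNReal.ofReal (S.indicator pi z) * ENNReal.ofReal (p z y) := by
  rw [← (h.hasSum_QS S y).tsum_eq, ENNReal.ofReal_tsum_of_nonneg
    (fun z => Set.indicator_nonneg (fun s _ => h.q0 s y) z) (h.hasSum_QS S y).summable]
  congr 1; funext z
  by_cases hz : z ∈ S
  · simp only [hz, indicator_of_mem]
    rw [ENNReal.ofReal_mul (h.pos z).le]
  · simp [hz]

lemma Ch.law_hit [Countable V] (h : Ch p pi γ) (x : V) (n : ℕ) (y : V) :
    ∫⁻ S, ENNReal.ofReal (S.indicator pi y) ∂(law pi p x n) =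
      ENNReal.ofReal (pi x) * ENNReal.ofReal (pn p n x y) := by
  induction n generalizing y with
  | zero =>
    rw [law, lintegral_dirac' _ (meas_ind pi y).ennreal_ofReal]
    by_cases hxy : x = y
    · subst hxy; simp [pn]
    · have : y ∉ ({x} : Set V) := fun hh => hxy hh.symm
      rw [indicator_of_notMem this]; simp [pn, hxy]
  | succ n ih =>
    rw [law_succ x n (meas_ind pi y).ennreal_ofReal]
    simp_rw [h.lint_ind _ y zero_le_one, one_mul, min_eq_right (h.QS_le_pi _ y), h.ofReal_QS]
    rw [lintegral_tsum fun z => ((meas_ind pi z).ennreal_ofReal.mul_const _).aemeasurable]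
    simp_rw [lintegral_mul_const _ (meas_ind pi _).ennreal_ofReal, ih]
    rw [h.ofReal_pn_succ, ← ENNReal.tsum_mul_left]
    congr 1; funext z; ring

lemma Ch.law_pi [Countable V] (h : Ch p pi γ) (x : V) (n : ℕ) :
    ∫⁻ S, ENNReal.ofReal (piS pi S) ∂(law pi p x n) = ENNReal.ofReal (pi x) := by
  simp_rw [h.ofReal_piS]
  rw [lintegral_tsum fun z => (meas_ind pi z).ennreal_ofReal.aemeasurable]
  simp_rw [h.law_hit x n]
  rw [ENNReal.tsum_mul_left, ← ENNReal.ofReal_tsum_of_nonneg (h.pn_nonneg n x) (h.pn_sum n x).summable,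
    (h.pn_sum n x).tsum_eq]
  simp

/-- expected root of the smaller mass -/
noncomputable def ee (pi : V → ℝ) (p : V → V → ℝ) (x : V) (n : ℕ) : ℝ≥0∞ :=
  ∫⁻ S, ENNReal.ofReal (√(mm pi S)) ∂(law pi p x n)

lemma meas_mm [Countable V] : Measurable (fun S : Set V => √(mm pi S)) := by
  have := meas_piS pi
  unfold mm
  fun_prop

noncomputable def DD (pi : V → ℝ) (A : ℝ) (S : Set V) : ℝ≥0∞ :=
  if A / 2 * piS pi S ≤ √(mm pi S) then ENNReal.ofReal (√(mm pi S)) else 0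

lemma meas_DD [Countable V] (A : ℝ) : Measurable (DD pi A) := by
  unfold DD
  refine Measurable.ite ?_ meas_mm.ennreal_ofReal measurable_const
  exact measurableSet_le ((meas_piS pi).const_mul _) meas_mm

lemma Ch.lint_mm [Countable V] (h : Ch p pi γ) (S : Set V) :
    ∫⁻ u in Ioc (0:ℝ) 1, ENNReal.ofReal (√(mm pi (esStep pi p S u))) =
      ENNReal.ofReal (∫ u in (0:ℝ)..1, √(mm pi (esStep pi p S u))) := by
  rw [intervalIntegral.integral_of_le zero_le_one, ofReal_integral_eq_lintegral_ofReal]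
  · refine Measure.integrableOn_of_bounded (M := 1) (by simp)
      (meas_mm.comp (h.meas_step S)).aestronglyMeasurable ?_
    refine Filter.Eventually.of_forall fun u => ?_
    rw [Real.norm_eq_abs, abs_of_nonneg (Real.sqrt_nonneg _)]
    exact Real.sqrt_le_one.2 ((min_le_left _ _).trans (h.piS_le_one _))
  · exact Filter.Eventually.of_forall fun u => Real.sqrt_nonneg _

lemma Ch.kap (h : Ch p pi γ) : 0 < γ ^ 2 / (2 * (1 - γ) ^ 2) := by
  have hg : 0 < 1 - γ := by have := h.g1; linarith
  have := h.g0
  positivity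

lemma Ch.step_E [Countable V] (h : Ch p pi γ) (S : Set V) {A : ℝ} (hA : 0 < A) :
    (∫⁻ u in Ioc (0:ℝ) 1, ENNReal.ofReal (√(mm pi (esStep pi p S u)))) +
      ENNReal.ofReal (γ ^ 2 / (2 * (1 - γ) ^ 2) * profile pi p (4 / A ^ 2) ^ 2) * DD pi A S
      ≤ ENNReal.ofReal (√(mm pi S)) := by
  have hk := h.kap
  set κ := γ ^ 2 / (2 * (1 - γ) ^ 2)
  rcases (h.mm_nonneg S).eq_or_lt with h0 | h0
  · have : ∫⁻ u in Ioc (0:ℝ) 1, ENNReal.ofReal (√(mm pi (esStep pi p S u))) = 0 := by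
      rw [setLIntegral_congr_fun (g := fun _ => 0) measurableSet_Ioc]
      · simp
      · intro u hu
        simp only
        rw [h.step_mm_zero S h0.symm u hu]; simp
    rw [this, DD, ← h0]; simp
  · rw [h.lint_mm, DD]
    have hm1 : mm pi S ≤ piS pi S := min_le_left _ _
    have hm2 : mm pi S ≤ 1 - piS pi S := min_le_right _ _
    have hn : 0 ≤ ∫ u in (0:ℝ)..1, √(mm pi (esStep pi p S u)) :=
      intervalIntegral.integral_nonneg zero_le_one fun u _ => Real.sqrt_nonneg _
    split_ifs with hc
    · rw [← ENNReal.ofReal_mul (by positivity), ← ENNReal.ofReal_add hn (by positivity)]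
      apply ENNReal.ofReal_le_ofReal
      have := h.step_mm S (profile pi p (4 / A ^ 2)) (h.profile_nonneg _) h0 (by
        intro T hT
        refine h.profile_le (hT ▸ h0) ?_ (by rw [hT]; linarith)
        rw [hT, le_div_iff₀ (by positivity)]
        have hs : 0 < √(mm pi S) := Real.sqrt_pos.2 h0
        have e := Real.sq_sqrt h0.le
        have h3 : A / 2 * (√(mm pi S)) ^ 2 ≤ √(mm pi S) := by
          rw [e]; exact le_trans (by gcongr) hc
        have h4 : A / 2 * √(mm pi S) ≤ 1 := by
          by_contra hh; push Not at hh
          nlinarith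
        have h5 : (A / 2 * √(mm pi S)) ^ 2 ≤ 1 := pow_le_one₀ (by positivity) h4
        rw [mul_pow, e] at h5
        linarith)
      have h6 : √(mm pi S) * (1 - κ * profile pi p (4 / A ^ 2) ^ 2) =
        √(mm pi S) - κ * profile pi p (4 / A ^ 2) ^ 2 * √(mm pi S) := by ring
      have h7 : (∫ u in (0:ℝ)..1, √(mm pi (esStep pi p S u))) ≤
        √(mm pi S) * (1 - κ * profile pi p (4 / A ^ 2) ^ 2) := this
      linarith
    · rw [mul_zero, add_zero]
      apply ENNReal.ofReal_le_ofReal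
      have := h.step_mm S 0 le_rfl h0 (fun T _ => h.cond_nonneg T)
      simpa using this

lemma Ch.drift [Countable V] (h : Ch p pi γ) (x : V) (n : ℕ) {A : ℝ} (hA : 0 < A) :
    ee pi p x (n + 1) + ENNReal.ofReal (γ ^ 2 / (2 * (1 - γ) ^ 2) * profile pi p (4 / A ^ 2) ^ 2) *
      (∫⁻ S, DD pi A S ∂(law pi p x n)) ≤ ee pi p x n := by
  rw [ee, law_succ x n meas_mm.ennreal_ofReal, ← lintegral_const_mul _ (meas_DD A),
    ← lintegral_add_right _ ((meas_DD A).const_mul _)]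
  exact lintegral_mono fun S => h.step_E S hA

lemma Ch.conc [Countable V] (h : Ch p pi γ) (x : V) (n : ℕ) {A : ℝ} (hA : 0 < A) :
    ee pi p x n ≤ (∫⁻ S, DD pi A S ∂(law pi p x n)) + ENNReal.ofReal (A / 2 * pi x) := by
  have : ENNReal.ofReal (A / 2 * pi x) = ∫⁻ S, ENNReal.ofReal (A / 2) * ENNReal.ofReal (piS pi S) ∂(law pi p x n) := by
    rw [lintegral_const_mul _ (meas_piS pi).ennreal_ofReal, h.law_pi, ENNReal.ofReal_mul (by positivity)]
  rw [this, ← lintegral_add_left (meas_DD A), ee]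
  refine lintegral_mono fun S => ?_
  simp only [DD]
  split_ifs with hc
  · exact le_self_add
  · push Not at hc
    rw [zero_add, ← ENNReal.ofReal_mul (by positivity)]
    exact ENNReal.ofReal_le_ofReal hc.le

lemma Ch.ee_zero [Countable V] (h : Ch p pi γ) (x : V) : ee pi p x 0 ≤ ENNReal.ofReal (√(pi x)) := by
  rw [ee, law, lintegral_dirac' _ meas_mm.ennreal_ofReal]
  apply ENNReal.ofReal_le_ofReal
  apply Real.sqrt_le_sqrt
  exact (min_le_left _ _).trans (piS_singleton x).le

lemma Ch.ee_anti [Countable V] (h : Ch p pi γ) (x : V) (n : ℕ) : ee pi p x (n + 1) ≤ ee pi p x n :=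
  le_trans le_self_add (h.drift x n one_pos)

lemma Ch.ee_fin [Countable V] (h : Ch p pi γ) (x : V) (n : ℕ) : ee pi p x n ≠ ⊤ := by
  induction n with
  | zero => exact ne_top_of_le_ne_top ENNReal.ofReal_ne_top (h.ee_zero x)
  | succ n ih => exact ne_top_of_le_ne_top ih (h.ee_anti x n)

/-- the normalised quantity -/
noncomputable def LL (pi : V → ℝ) (p : V → V → ℝ) (x : V) (n : ℕ) : ℝ := (ee pi p x n).toReal / pi x

lemma Ch.LL_nonneg (h : Ch p pi γ) (x : V) (n : ℕ) : 0 ≤ LL pi p x n :=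
  div_nonneg ENNReal.toReal_nonneg (h.pos x).le

lemma Ch.LL_zero [Countable V] (h : Ch p pi γ) (x : V) : LL pi p x 0 ≤ 1 / √(pi x) := by
  have hp := h.pos x
  have h1 := ENNReal.toReal_le_of_le_ofReal (Real.sqrt_nonneg _) (h.ee_zero x)
  unfold LL
  have hs := Real.sqrt_pos.2 hp
  rw [div_le_div_iff₀ hp hs, one_mul]
  nlinarith [Real.mul_self_sqrt hp.le]

lemma Ch.LL_step [Countable V] (h : Ch p pi γ) (x : V) (n : ℕ) (hL : 0 < LL pi p x n) :
    LL pi p x (n + 1) ≤ LL pi p x n *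
      (1 - γ ^ 2 / (2 * (1 - γ) ^ 2) * profile pi p (4 / LL pi p x n ^ 2) ^ 2 / 2) := by
  have hp := h.pos x
  have hk := h.kap
  have eA : (ee pi p x n).toReal = LL pi p x n * pi x := by unfold LL; field_simp
  set A := LL pi p x n with hAd
  have d := h.drift x n hL
  have c := h.conc x n hL
  set κ := γ ^ 2 / (2 * (1 - γ) ^ 2)
  set φ := profile pi p (4 / A ^ 2)
  set I := ∫⁻ S, DD pi A S ∂(law pi p x n)
  have hIf : I ≠ ⊤ := by
    refine ne_top_of_le_ne_top (h.ee_fin x n) (lintegral_mono fun S => ?_)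
    simp only [DD]; split_ifs
    · exact le_rfl
    · exact zero_le
  have c' := ENNReal.toReal_mono (by finiteness) c
  rw [ENNReal.toReal_add hIf (by finiteness), ENNReal.toReal_ofReal (by positivity)] at c'
  have d' := ENNReal.toReal_mono (h.ee_fin x n) d
  rw [ENNReal.toReal_add (h.ee_fin x _) (by finiteness), ENNReal.toReal_mul,
    ENNReal.toReal_ofReal (by positivity)] at d'
  rw [eA] at c' d'
  unfold LL
  rw [div_le_iff₀ hp]
  have hkφ : 0 ≤ κ * φ ^ 2 := by positivity
  nlinarith

end process

section final
variable {p : V → V → ℝ} {pi : V → ℝ} {γ : ℝ}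

lemma Ch.rev_ck (h : Ch p pi γ) (m : ℕ) (x y : V) : ∀ n : ℕ,
    ∑' z, ENNReal.ofReal (1 / pi z) * (ENNReal.ofReal (pn p n x z) *
      ENNReal.ofReal (pn (EvolvingSetsPaper.rev p pi) m y z)) =
      ENNReal.ofReal (1 / pi y) * ENNReal.ofReal (pn p (n + m) x y) := by
  induction m with
  | zero =>
    intro n
    rw [tsum_eq_single y]
    · simp [pn]
    · intro z hz
      simp [pn, hz.symm]
  | succ m ih =>
    intro n
    have e := ih (n + 1)
    rw [show n + (m + 1) = n + 1 + m by ring, ← e]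
    simp_rw [h.rev.ofReal_pn_succ m y, h.ofReal_pn_succ n x, ← ENNReal.tsum_mul_left,
      ← ENNReal.tsum_mul_right, ← ENNReal.tsum_mul_left]
    rw [ENNReal.tsum_comm]
    congr 1; funext w; congr 1; funext z
    have : ENNReal.ofReal (1 / pi z) * ENNReal.ofReal (EvolvingSetsPaper.rev p pi w z) =
        ENNReal.ofReal (1 / pi w) * ENNReal.ofReal (p z w) := by
      have hz := h.pos z
      have hw := h.pos w
      rw [← ENNReal.ofReal_mul (by positivity), ← ENNReal.ofReal_mul (by positivity)]
      congr 1
      unfold EvolvingSetsPaper.rev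
      field_simp
    calc _ = (ENNReal.ofReal (1 / pi z) * ENNReal.ofReal (EvolvingSetsPaper.rev p pi w z)) *
          (ENNReal.ofReal (pn p n x z) * ENNReal.ofReal (pn (EvolvingSetsPaper.rev p pi) m y w)) := by ring
      _ = _ := by rw [this]; ring

lemma Ch.cov (h : Ch p pi γ) (S T : Set V) :
    |piS pi (S ∩ T) - piS pi S * piS pi T| ≤ √(mm pi S) * √(mm pi T) := by
  have s0 := h.piS_nonneg S
  have t0 := h.piS_nonneg T
  have s1 := h.piS_le_one S
  have t1 := h.piS_le_one T
  have a0 := h.piS_nonneg (S ∩ T)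
  have aS := h.piS_mono (inter_subset_left : S ∩ T ⊆ S)
  have aT := h.piS_mono (inter_subset_right : S ∩ T ⊆ T)
  have aU : piS pi S + piS pi T - 1 ≤ piS pi (S ∩ T) := by
    have h1 := (h.hasSum_piS S).add (h.hasSum_piS T)
    have h2 := h.pi1.add (h.hasSum_piS (S ∩ T))
    have := hasSum_le (fun y => ?_) h1 h2
    · linarith
    · have := h.pos y
      by_cases hs : y ∈ S <;> by_cases ht : y ∈ T <;> simp [hs, ht] <;> linarith
  set a := piS pi (S ∩ T)
  set s := piS pi S with hs
  set t := piS pi T with ht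
  have b1 : |a - s * t| ≤ mm pi S := by
    unfold mm; rw [← hs]
    refine abs_le.2 ⟨?_, le_min ?_ ?_⟩
    · rcases min_choice s (1 - s) with e | e <;> rw [e] <;> nlinarith
    · nlinarith
    · nlinarith
  have b2 : |a - s * t| ≤ mm pi T := by
    unfold mm; rw [← ht]
    refine abs_le.2 ⟨?_, le_min ?_ ?_⟩
    · rcases min_choice t (1 - t) with e | e <;> rw [e] <;> nlinarith
    · nlinarith
    · nlinarith
  rw [← Real.sqrt_mul (h.mm_nonneg S)]
  apply Real.le_sqrt_of_sq_le
  rw [sq]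
  exact mul_le_mul b1 b2 (abs_nonneg _) (h.mm_nonneg S)

lemma meas_inter [Countable V] (S : Set V) : Measurable (fun T : Set V => piS pi (S ∩ T)) := by
  refine (meas_piS pi).comp ?_
  rw [measurable_set_iff]
  intro a
  exact (measurable_const (a := a ∈ S)).and (measurable_set_mem a)

lemma Ch.lint2 [Countable V] (h : Ch p pi γ) (x y : V) (n m : ℕ) :
    ∫⁻ S, ∫⁻ T, ENNReal.ofReal (piS pi (S ∩ T)) ∂(law pi (EvolvingSetsPaper.rev p pi) y m)
      ∂(law pi p x n) = ENNReal.ofReal (pi x * pn p (n + m) x y) := by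
  have e : ∀ S T : Set V, ENNReal.ofReal (piS pi (S ∩ T)) =
      ∑' z, (ENNReal.ofReal (1 / pi z) * ENNReal.ofReal (S.indicator pi z)) *
        ENNReal.ofReal (T.indicator pi z) := by
    intro S T
    rw [h.ofReal_piS]
    congr 1; funext z
    have := h.pos z
    by_cases hs : z ∈ S <;> by_cases ht : z ∈ T <;> simp [hs, ht]
    rw [← ENNReal.ofReal_mul (by positivity), inv_mul_cancel₀ this.ne']
    simp
  simp_rw [e]
  have e2 : ∀ S : Set V, ∫⁻ T, ∑' z, (ENNReal.ofReal (1 / pi z) * ENNReal.ofReal (S.indicator pi z)) *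
        ENNReal.ofReal (T.indicator pi z) ∂(law pi (EvolvingSetsPaper.rev p pi) y m) =
      ∑' z, ENNReal.ofReal (S.indicator pi z) * (ENNReal.ofReal (1 / pi z) *
        (ENNReal.ofReal (pi y) * ENNReal.ofReal (pn (EvolvingSetsPaper.rev p pi) m y z))) := by
    intro S
    rw [lintegral_tsum fun z => ((meas_ind pi z).ennreal_ofReal.const_mul _).aemeasurable]
    congr 1; funext z
    rw [lintegral_const_mul _ (meas_ind pi z).ennreal_ofReal, h.rev.law_hit]
    ring
  simp_rw [e2]
  rw [lintegral_tsum fun z => ((meas_ind pi z).ennreal_ofReal.mul_const _).aemeasurable]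
  simp_rw [lintegral_mul_const _ (meas_ind pi _).ennreal_ofReal, h.law_hit]
  have e3 := h.rev_ck m x y n
  have hy := h.pos y
  have hx := h.pos x
  calc _ = ∑' z, (ENNReal.ofReal (pi x) * ENNReal.ofReal (pi y)) * (ENNReal.ofReal (1 / pi z) * (ENNReal.ofReal (pn p n x z) *
      ENNReal.ofReal (pn (EvolvingSetsPaper.rev p pi) m y z))) := by
        congr 1; funext z; ring
    _ = _ := by
        rw [ENNReal.tsum_mul_left, e3, ← ENNReal.ofReal_mul (by positivity),
          ← ENNReal.ofReal_mul (by positivity), ← ENNReal.ofReal_mul (by positivity)]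
        congr 1; field_simp

lemma Ch.main_bound [Countable V] (h : Ch p pi γ) (x y : V) (n m : ℕ) :
    |pn p (n + m) x y / pi y - 1| ≤ LL pi p x n * LL pi (EvolvingSetsPaper.rev p pi) y m := by
  have hx := h.pos x
  have hy := h.pos y
  set q := EvolvingSetsPaper.rev p pi
  have hc : ∀ S T, piS pi (S ∩ T) ≤ piS pi S * piS pi T + √(mm pi S) * √(mm pi T) ∧
      piS pi S * piS pi T ≤ piS pi (S ∩ T) + √(mm pi S) * √(mm pi T) := by
    intro S T
    have := abs_le.1 (h.cov S T)
    constructor <;> linarith [this.1, this.2]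
  have mp := (meas_piS pi).ennreal_ofReal
  have mq := (meas_mm (pi := pi)).ennreal_ofReal
  have I1 : ∫⁻ S, ∫⁻ T, ENNReal.ofReal (piS pi S * piS pi T) ∂(law pi q y m) ∂(law pi p x n) =
      ENNReal.ofReal (pi x * pi y) := by
    simp_rw [fun S T : Set V => ENNReal.ofReal_mul (q := piS pi T) (h.piS_nonneg S)]
    simp_rw [lintegral_const_mul _ mp, lintegral_mul_const _ mp]
    rw [h.rev.law_pi, h.law_pi, ENNReal.ofReal_mul hx.le]
  have I2 : ∫⁻ S, ∫⁻ T, ENNReal.ofReal (√(mm pi S) * √(mm pi T)) ∂(law pi q y m) ∂(law pi p x n) =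
      ee pi p x n * ee pi q y m := by
    simp_rw [fun S T : Set V => ENNReal.ofReal_mul (q := √(mm pi T)) (Real.sqrt_nonneg (mm pi S))]
    simp_rw [lintegral_const_mul _ mq, lintegral_mul_const _ mq]
    rfl
  have I3 := h.lint2 x y n m
  have m2 : ∀ S, Measurable fun T => ENNReal.ofReal (√(mm pi S) * √(mm pi T)) :=
    fun S => (meas_mm.const_mul _).ennreal_ofReal
  have m3 : Measurable fun S => ∫⁻ T, ENNReal.ofReal (√(mm pi S) * √(mm pi T)) ∂(law pi q y m) := by
    simp_rw [fun S T : Set V => ENNReal.ofReal_mul (q := √(mm pi T)) (Real.sqrt_nonneg (mm pi S))]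
    simp_rw [lintegral_const_mul _ mq]
    exact mq.mul_const _
  have J1 : ENNReal.ofReal (pi x * pn p (n + m) x y) ≤
      ENNReal.ofReal (pi x * pi y) + ee pi p x n * ee pi q y m := by
    rw [← I1, ← I2, ← I3, ← lintegral_add_right _ m3]
    refine lintegral_mono fun S => ?_
    simp only
    rw [← lintegral_add_right _ (m2 S)]
    refine lintegral_mono fun T => ?_
    simp only
    rw [← ENNReal.ofReal_add (mul_nonneg (h.piS_nonneg _) (h.piS_nonneg _)) (by positivity)]
    exact ENNReal.ofReal_le_ofReal (hc S T).1
  have J2 : ENNReal.ofReal (pi x * pi y) ≤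
      ENNReal.ofReal (pi x * pn p (n + m) x y) + ee pi p x n * ee pi q y m := by
    rw [← I1, ← I2, ← I3, ← lintegral_add_right _ m3]
    refine lintegral_mono fun S => ?_
    simp only
    rw [← lintegral_add_right _ (m2 S)]
    refine lintegral_mono fun T => ?_
    simp only
    rw [← ENNReal.ofReal_add (h.piS_nonneg _) (by positivity)]
    exact ENNReal.ofReal_le_ofReal (hc S T).2
  have f1 := h.ee_fin x n
  have f2 := h.rev.ee_fin y m
  have hpn := h.pn_nonneg (n + m) x y
  have J1' := ENNReal.toReal_mono (by finiteness) J1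
  have J2' := ENNReal.toReal_mono (by finiteness) J2
  rw [ENNReal.toReal_add (by finiteness) (by finiteness), ENNReal.toReal_mul,
    ENNReal.toReal_ofReal (by positivity), ENNReal.toReal_ofReal (by positivity)] at J1' J2'
  have : pn p (n + m) x y / pi y - 1 = (pi x * pn p (n + m) x y - pi x * pi y) / (pi x * pi y) := by
    field_simp
  rw [this, abs_div, abs_of_pos (mul_pos hx hy)]
  have e : LL pi p x n * LL pi q y m =
      (ee pi p x n).toReal * (ee pi q y m).toReal / (pi x * pi y) := by
    unfold LL; field_simp
  rw [e]
  apply div_le_div_of_nonneg_right _ (by positivity)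
  exact abs_le.2 ⟨by linarith, by linarith⟩

lemma lint_log {a b K : ℝ} (ha : 0 < a) (hab : a ≤ b) (hK : 0 ≤ K) :
    ∫⁻ u in Ioc a b, ENNReal.ofReal (K * (1 / u)) = ENNReal.ofReal (K * Real.log (b / a)) := by
  rw [← integral_one_div_of_pos ha (ha.trans_le hab), ← intervalIntegral.integral_const_mul,
    intervalIntegral.integral_of_le hab, ofReal_integral_eq_lintegral_ofReal]
  · have : IntervalIntegrable (fun u : ℝ => K * (1 / u)) volume a b := by
      apply IntervalIntegrable.const_mul
      apply intervalIntegral.intervalIntegrable_one_div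
      · intro u hu
        rw [uIcc_of_le hab] at hu
        exact (ha.trans_le hu.1).ne'
      · fun_prop
    exact (intervalIntegrable_iff_integrableOn_Ioc_of_le hab).1 this
  · filter_upwards [ae_restrict_mem measurableSet_Ioc] with u hu
    have : 0 < u := ha.trans hu.1
    simp only [Pi.zero_apply]
    positivity

lemma seg {F : ℝ → ℝ} {a r s : ℝ} (ha : 0 < a)
    (hF0 : ∀ r, 0 ≤ F r) (hF : ∀ r s, 4 * a ≤ r → r ≤ s → F s ≤ F r)
    (har : 4 * a ≤ r) (hrs : r ≤ s) (hr : 0 < F r) :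
    ENNReal.ofReal (4 / F r ^ 2 * Real.log (s / r)) ≤
      ∫⁻ u in Ioc r s, 4 / ENNReal.ofReal (u * F u ^ 2) := by
  have hr0 : 0 < r := by linarith
  rw [← lint_log hr0 hrs (by positivity)]
  refine setLIntegral_mono' measurableSet_Ioc fun u hu => ?_
  have hu0 : 0 < u := hr0.trans hu.1
  have h1 := hF r u har hu.1.le
  rcases (hF0 u).eq_or_lt with h0 | h0
  · rw [← h0]
    have : (4 : ℝ≥0∞) / 0 = ⊤ := ENNReal.div_zero (by norm_num)
    simp [this]
  · rw [show (4 : ℝ≥0∞) = ENNReal.ofReal 4 by simp, ← ENNReal.ofReal_div_of_pos (by positivity)]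
    apply ENNReal.ofReal_le_ofReal
    rw [div_mul_div_comm, mul_one, mul_comm u]
    gcongr

lemma iter {L : ℕ → ℝ} {F : ℝ → ℝ} {κ a ε : ℝ} (hκ : 0 < κ) (ha : 0 < a) (hε : 0 < ε)
    (hL0 : ∀ n, 0 ≤ L n) (hLz : L 0 ≤ 1 / √a) (hanti : Antitone L)
    (hst : ∀ n, 0 < L n → L (n + 1) ≤ L n * (1 - κ * F (4 / L n ^ 2) ^ 2 / 2))
    (hF0 : ∀ r, 0 ≤ F r) (hF : ∀ r s, 4 * a ≤ r → r ≤ s → F s ≤ F r) (n : ℕ)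
    (hn : (∫⁻ u in Ioc (4 * a) (4 / ε), 4 / ENNReal.ofReal (u * F u ^ 2)) ≤
      n * ENNReal.ofReal (4 * κ)) : L n ≤ √ε := by
  by_contra hcon
  push Not at hcon
  have hse := Real.sqrt_pos.2 hε
  have hsa := Real.sqrt_pos.2 ha
  have hk : ∀ k ≤ n, √ε < L k := fun k hk => hcon.trans_le (hanti hk)
  have hkp : ∀ k ≤ n, 0 < L k := fun k h => hse.trans (hk k h)
  have hv1 : ∀ k ≤ n, 4 / L k ^ 2 < 4 / ε := by
    intro k h
    have : ε < L k ^ 2 := by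
      rw [← Real.sq_sqrt hε.le]
      exact pow_lt_pow_left₀ (hk k h) hse.le two_ne_zero
    gcongr
  have hv0 : ∀ k ≤ n, 4 * a ≤ 4 / L k ^ 2 := by
    intro k h
    have h1 : L k ≤ 1 / √a := (hanti (Nat.zero_le k)).trans hLz
    have h2 : L k ^ 2 ≤ (1 / √a) ^ 2 := pow_le_pow_left₀ (hL0 k) h1 2
    rw [div_pow, Real.sq_sqrt ha.le, one_pow, le_div_iff₀ ha] at h2
    have := hkp k h
    rw [le_div_iff₀ (by positivity)]
    linarith
  set G := fun u : ℝ => 4 / ENNReal.ofReal (u * F u ^ 2) with hG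
  have hn' : (∫⁻ u in Ioc (4 * a) (4 / ε), G u) ≤ n * ENNReal.ofReal (4 * κ) := hn
  have hfin : (∫⁻ u in Ioc (4 * a) (4 / ε), G u) ≠ ⊤ := ne_top_of_le_ne_top (by finiteness) hn'
  have hsplit : ∀ r s, 4 * a ≤ r → r ≤ s → (∫⁻ u in Ioc (4 * a) s, G u) =
      (∫⁻ u in Ioc (4 * a) r, G u) + ∫⁻ u in Ioc r s, G u := by
    intro r s h1 h2
    rw [← Ioc_union_Ioc_eq_Ioc h1 h2, lintegral_union measurableSet_Ioc]
    exact Set.disjoint_left.2 fun u hu hu' => absurd hu'.1 (not_lt.2 hu.2)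
  have hFp : ∀ k ≤ n, 0 < F (4 / L k ^ 2) := by
    intro k h
    rcases (hF0 (4 / L k ^ 2)).eq_or_lt with h0 | h0
    · exfalso
      apply hfin
      rw [hsplit _ _ (hv0 k h) (hv1 k h).le]
      have : (∫⁻ u in Ioc (4 / L k ^ 2) (4 / ε), G u) = ⊤ := by
        rw [setLIntegral_congr_fun (g := fun _ => (⊤ : ℝ≥0∞)) measurableSet_Ioc]
        · rw [setLIntegral_const, Real.volume_Ioc, ENNReal.top_mul]
          simpa using hv1 k h
        · intro u hu
          have : F u = 0 := le_antisymm (h0 ▸ hF _ u (hv0 k h) hu.1.le) (hF0 u)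
          have h4 : (4 : ℝ≥0∞) / 0 = ⊤ := ENNReal.div_zero (by norm_num)
          simp [hG, this, h4]
      rw [this]; simp
    · exact h0
  have claim : ∀ k ≤ n, k * ENNReal.ofReal (4 * κ) ≤ ∫⁻ u in Ioc (4 * a) (4 / L k ^ 2), G u := by
    intro k
    induction k with
    | zero => intro _; simp
    | succ k ih =>
      intro h
      have hk1 : k ≤ n := by omega
      have hp := hkp k hk1
      have hp' := hkp (k + 1) h
      have hle : 4 / L k ^ 2 ≤ 4 / L (k + 1) ^ 2 := by
        have := hanti (Nat.le_succ k)
        gcongr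
      rw [hsplit _ _ (hv0 k hk1) hle]
      push_cast
      rw [add_mul, one_mul]
      refine add_le_add (ih hk1) ?_
      refine le_trans ?_ (seg ha hF0 hF (hv0 k hk1) hle (hFp k hk1))
      apply ENNReal.ofReal_le_ofReal
      have hs := hst k hp
      have hf := hFp k hk1
      set f := F (4 / L k ^ 2)
      have e1 : (4 / L (k + 1) ^ 2) / (4 / L k ^ 2) = (L k / L (k + 1)) ^ 2 := by field_simp
      have e2 : Real.log (L (k + 1) / L k) ≤ - (κ * f ^ 2 / 2) := by
        have h1 : L (k + 1) / L k ≤ 1 - κ * f ^ 2 / 2 := by rw [div_le_iff₀ hp]; linarith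
        have h2 := Real.log_le_sub_one_of_pos (div_pos hp' hp)
        linarith
      rw [e1, Real.log_pow, ← inv_div (L (k + 1)), Real.log_inv, div_mul_eq_mul_div, le_div_iff₀ (by positivity)]
      push_cast
      nlinarith
  have c1 := claim n le_rfl
  rw [hsplit _ _ (hv0 n le_rfl) (hv1 n le_rfl).le] at hn'
  have hpos : 0 < ∫⁻ u in Ioc (4 / L n ^ 2) (4 / ε), G u := by
    refine lt_of_lt_of_le ?_ (seg ha hF0 hF (hv0 n le_rfl) (hv1 n le_rfl).le (hFp n le_rfl))
    have := hFp n le_rfl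
    have h3 := hkp n le_rfl
    have : 0 < Real.log (4 / ε / (4 / L n ^ 2)) := by
      apply Real.log_pos
      rw [one_lt_div (by positivity)]
      exact hv1 n le_rfl
    rw [ENNReal.ofReal_pos]
    positivity
  have c2 := (add_le_add_left c1 _).trans hn'
  have : (n : ℝ≥0∞) * ENNReal.ofReal (4 * κ) < n * ENNReal.ofReal (4 * κ) + ∫⁻ u in Ioc (4 / L n ^ 2) (4 / ε), G u :=
    ENNReal.lt_add_right (by finiteness) hpos.ne'
  exact absurd c2 (not_le.2 this)

lemma Ch.half [Countable V] [Nontrivial V] (h : Ch p pi γ) (x : V) {ε : ℝ} (hε : 0 < ε) (n : ℕ)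
    (hn : ENNReal.ofReal ((1 - γ) ^ 2 / γ ^ 2) *
      (∫⁻ u in Ioc (4 * pi x) (4 / ε), 4 / ENNReal.ofReal (u * profile pi p u ^ 2)) ≤
      2 * (n : ℝ≥0∞)) : LL pi p x n ≤ √ε := by
  have hg : 0 < 1 - γ := by have := h.g1; linarith
  have hg0 := h.g0
  have hp := h.pos x
  refine iter h.kap hp hε (h.LL_nonneg x) (h.LL_zero x) ?_ (h.LL_step x) h.profile_nonneg
    (fun r s h1 h2 => h.profile_anti (x := x) (by linarith) h2) n ?_
  · refine antitone_nat_of_succ_le fun k => ?_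
    unfold LL
    exact div_le_div_of_nonneg_right (ENNReal.toReal_mono (h.ee_fin x k) (h.ee_anti x k)) hp.le
  · set J := ∫⁻ u in Ioc (4 * pi x) (4 / ε), 4 / ENNReal.ofReal (u * profile pi p u ^ 2)
    have e : ENNReal.ofReal (γ ^ 2 / (1 - γ) ^ 2) * ENNReal.ofReal ((1 - γ) ^ 2 / γ ^ 2) = 1 := by
      rw [← ENNReal.ofReal_mul (by positivity), ← ENNReal.ofReal_one]
      congr 1; field_simp
    calc J = ENNReal.ofReal (γ ^ 2 / (1 - γ) ^ 2) * (ENNReal.ofReal ((1 - γ) ^ 2 / γ ^ 2) * J) := by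
          rw [← mul_assoc, e, one_mul]
      _ ≤ ENNReal.ofReal (γ ^ 2 / (1 - γ) ^ 2) * (2 * n) := by gcongr
      _ = n * (ENNReal.ofReal (γ ^ 2 / (1 - γ) ^ 2) * ENNReal.ofReal 2) := by simp; ring
      _ = _ := by
          rw [← ENNReal.ofReal_mul (by positivity)]
          congr 2; field_simp; ring

end final

lemma hasSum_unique_aux {f : V → ℝ} {c : ℝ} (y : V) (hV : Subsingleton V) (hf : HasSum f c) :
    f y = c := by
  have : HasSum f (f y) := hasSum_single y fun z hz => absurd (Subsingleton.elim z y) hz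
  exact this.unique hf

/-- Theorem (hk2): uniform mixing bound from the conductance profile under
the weaker laziness assumption `p(x,x) ≥ γ`, `0 < γ ≤ 1/2`. -/
theorem uniform_mixing_from_conductance_gamma [Countable V] [Nonempty V]
    (p : V → V → ℝ) (pi : V → ℝ)
    (hp0 : ∀ x y, 0 ≤ p x y) (hp1 : ∀ x, ∑' y, p x y = 1)
    (hpipos : ∀ x, 0 < pi x) (hpi1 : ∑' x, pi x = 1)
    (hstat : ∀ y, ∑' x, pi x * p x y = pi y)
    (hirr : ∀ x y : V, ∃ n, 0 < pn p n x y)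
    (γ : ℝ) (hγ0 : 0 < γ) (hγ : γ ≤ 1 / 2)
    (hlazy : ∀ x, γ ≤ p x x)
    (ε : ℝ) (hε : 0 < ε) :
    ∀ (x y : V) (n : ℕ),
      1 + ENNReal.ofReal ((1 - γ) ^ 2 / γ ^ 2) *
          (∫⁻ u in Ioc (4 * min (pi x) (pi y)) (4 / ε),
            4 / ENNReal.ofReal (u * profile pi p u ^ 2)) ≤ (n : ℝ≥0∞) →
      |pn p n x y / pi y - 1| ≤ ε := by
  intro x y N hN
  have hsum : ∀ {f : V → ℝ} {c : ℝ}, c ≠ 0 → ∑' z, f z = c → HasSum f c := by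
    intro f c hc hf
    have : Summable f := by
      by_contra hns
      exact hc (hf ▸ tsum_eq_zero_of_not_summable hns)
    exact hf ▸ this.hasSum
  have h : Ch p pi γ :=
    { p0 := hp0, p1 := fun x => hsum one_ne_zero (hp1 x), pos := hpipos,
      pi1 := hsum one_ne_zero hpi1, st := fun y => hsum (hpipos y).ne' (hstat y),
      g0 := hγ0, g1 := hγ, lazy := hlazy }
  rcases subsingleton_or_nontrivial V with hV | hV
  · have e1 : pi y = 1 := (hasSum_unique_aux y hV h.pi1)
    have e2 : pn p N x y = 1 := (hasSum_unique_aux y hV (h.pn_sum N x))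
    rw [e1, e2]; simpa using hε.le
  · have hmono : ∀ w, min (pi x) (pi y) ≤ pi w → ∀ n : ℕ, N ≤ 2 * n + 1 →
        ENNReal.ofReal ((1 - γ) ^ 2 / γ ^ 2) *
          (∫⁻ u in Ioc (4 * pi w) (4 / ε), 4 / ENNReal.ofReal (u * profile pi p u ^ 2)) ≤
          2 * (n : ℝ≥0∞) := by
      intro w hw n hn
      have h1 : (N : ℝ≥0∞) ≤ 1 + 2 * (n : ℝ≥0∞) := by
        rw [add_comm]; exact_mod_cast hn
      have h2 := (ENNReal.add_le_add_iff_left ENNReal.one_ne_top).1 (hN.trans h1)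
      refine le_trans ?_ h2
      gcongr
    have hx := h.half x hε (N / 2) (hmono x (min_le_left _ _) _ (by omega))
    have hy := h.rev.half y hε (N - N / 2) (by
      rw [h.profile_rev]
      exact hmono y (min_le_right _ _) _ (by omega))
    have hm := h.main_bound x y (N / 2) (N - N / 2)
    rw [show N / 2 + (N - N / 2) = N by omega] at hm
    refine hm.trans ?_
    calc _ ≤ √ε * √ε := mul_le_mul hx hy (h.rev.LL_nonneg _ _) (Real.sqrt_nonneg _)
      _ = ε := Real.mul_self_sqrt hε.le

end EvolvingSetsPaper
end
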